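/- arXiv:2405.12499 — 2 statements merged into one kernel-verified Lean document; each statement's English description precedes it below -/
import Mathlib

section
/- Let g ∈ C_b(ℝ²) (bounded continuous) and f ∈ BV_V(ℝ²). Then: (i) the function V(f; t₁, t₂) := Var(f, (−∞, t₁] × (−∞, t₂]) belongs to BV_V(ℝ²); and (ii) |∬_{ℝ²} g(t₁,t₂) df(t₁,t₂)| ≤ ∬_{ℝ²} |g(t₁,t₂)| dV(f; t₁,t₂), where the integrals are improper Riemann–Stieltjes integrals (limits in the Pringsheim sense over expanding compact rectangles). -/
open Set Filter MeasureTheory Real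
open scoped Topology ENNReal

noncomputable section

/-- Sum of absolute second-order rectangular increments of `f` over the grid `x`, `y`. -/
def vitaliSum (f : ℝ → ℝ → ℝ) (x y : ℕ → ℝ) (n m : ℕ) : ℝ :=
  ∑ i ∈ Finset.range n, ∑ j ∈ Finset.range m,
    |f (x (i+1)) (y (j+1)) - f (x i) (y (j+1)) - f (x (i+1)) (y j) + f (x i) (y j)|

/-- Vitali variation of `f` over a set `Q ⊆ ℝ²`: the supremum, over compact rectangles
contained in `Q` and partitions of them, of the sum of absolute rectangular increments. -/
def vitaliVar (f : ℝ → ℝ → ℝ) (Q : Set (ℝ × ℝ)) : ℝ≥0∞ :=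
  ⨆ (n : ℕ) (m : ℕ) (x : ℕ → ℝ) (y : ℕ → ℝ)
    (_ : ∀ i < n, x i < x (i+1)) (_ : ∀ j < m, y j < y (j+1))
    (_ : Set.Icc (x 0) (x n) ×ˢ Set.Icc (y 0) (y m) ⊆ Q),
    ENNReal.ofReal (vitaliSum f x y n m)

/-- Bounded variation in the sense of Vitali over `ℝ²`. -/
def BVV (f : ℝ → ℝ → ℝ) : Prop := vitaliVar f Set.univ < ⊤

/-- Bounded variation in the sense of Hardy over `ℝ²`. -/
def BVH (f : ℝ → ℝ → ℝ) : Prop :=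
  BVV f ∧ (∀ y, BoundedVariationOn (fun s => f s y) Set.univ) ∧
    (∀ x, BoundedVariationOn (fun s => f x s) Set.univ)

/-- The space `BV_{||0||}(ℝ²)`: Vitali bounded variation and vanishing as `‖(x,y)‖ → ∞`. -/
def BVzero (f : ℝ → ℝ → ℝ) : Prop :=
  BVV f ∧ Tendsto (fun p : ℝ × ℝ => f p.1 p.2) (cocompact (ℝ × ℝ)) (𝓝 0)

/-- `x`, `y` form a partition of `[a,b] × [c,d]` with `n`, resp. `m`, subintervals. -/
def IsPartition (x y : ℕ → ℝ) (n m : ℕ) (a b c d : ℝ) : Prop :=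
  x 0 = a ∧ x n = b ∧ y 0 = c ∧ y m = d ∧
    (∀ i < n, x i < x (i+1)) ∧ (∀ j < m, y j < y (j+1))

/-- The tags `(ξ i j, η i j)` belong to the corresponding subrectangles. -/
def Tags (x y : ℕ → ℝ) (ξ η : ℕ → ℕ → ℝ) (n m : ℕ) : Prop :=
  ∀ i < n, ∀ j < m,
    ξ i j ∈ Set.Icc (x i) (x (i+1)) ∧ η i j ∈ Set.Icc (y j) (y (j+1))

/-- Riemann–Stieltjes sum of `g` with respect to `f`. -/
def RSSum (g f : ℝ → ℝ → ℝ) (x y : ℕ → ℝ) (ξ η : ℕ → ℕ → ℝ) (n m : ℕ) : ℝ :=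
  ∑ i ∈ Finset.range n, ∑ j ∈ Finset.range m,
    g (ξ i j) (η i j) *
      (f (x (i+1)) (y (j+1)) - f (x i) (y (j+1)) - f (x (i+1)) (y j) + f (x i) (y j))

/-- `g` is Riemann–Stieltjes integrable with respect to `f` over `[a,b] × [c,d]`,
with integral `A` (mesh measured by the diagonals of the subrectangles). -/
def RSIntegralOn (g f : ℝ → ℝ → ℝ) (a b c d A : ℝ) : Prop :=
  ∀ ε > 0, ∃ δ > 0, ∀ (n m : ℕ) (x y : ℕ → ℝ) (ξ η : ℕ → ℕ → ℝ),
    IsPartition x y n m a b c d → Tags x y ξ η n m →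
    (∀ i < n, ∀ j < m, Real.sqrt ((x (i+1) - x i)^2 + (y (j+1) - y j)^2) < δ) →
    |RSSum g f x y ξ η n m - A| < ε

/-- Improper Riemann–Stieltjes integral of `g` with respect to `f` over `ℝ²`,
as a Pringsheim limit over expanding compact rectangles. -/
def ImproperRS (g f : ℝ → ℝ → ℝ) (A : ℝ) : Prop :=
  ∀ ε > 0, ∃ M : ℝ, ∀ a b c d : ℝ, a ≤ -M → M ≤ b → c ≤ -M → M ≤ d →
    ∃ B : ℝ, RSIntegralOn g f a b c d B ∧ |B - A| < ε

/-- Improper Riemann–Stieltjes integral of a complex-valued `G` with respect to `f`,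
defined via real and imaginary parts. -/
def ImproperRSC (G : ℝ → ℝ → ℂ) (f : ℝ → ℝ → ℝ) (A : ℂ) : Prop :=
  ImproperRS (fun s t => (G s t).re) f A.re ∧ ImproperRS (fun s t => (G s t).im) f A.im

/-- Riemann sum of `f` over a tagged partition. -/
def KHSum (f : ℝ → ℝ → ℝ) (x y : ℕ → ℝ) (ξ η : ℕ → ℕ → ℝ) (n m : ℕ) : ℝ :=
  ∑ i ∈ Finset.range n, ∑ j ∈ Finset.range m,
    f (ξ i j) (η i j) * (x (i+1) - x i) * (y (j+1) - y j)

/-- The tagged partition is `δ`-fine for the gauge `δ`. -/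
def KHFine (δ : ℝ × ℝ → ℝ) (x y : ℕ → ℝ) (ξ η : ℕ → ℕ → ℝ) (n m : ℕ) : Prop :=
  ∀ i < n, ∀ j < m,
    Set.Icc (x i) (x (i+1)) ⊆
      Set.Ioo (ξ i j - δ (ξ i j, η i j)) (ξ i j + δ (ξ i j, η i j)) ∧
    Set.Icc (y j) (y (j+1)) ⊆
      Set.Ioo (η i j - δ (ξ i j, η i j)) (η i j + δ (ξ i j, η i j))

/-- `f` is Kurzweil–Henstock integrable over `[a,b] × [c,d]` with integral `A`. -/
def KHIntegralOn (f : ℝ → ℝ → ℝ) (a b c d A : ℝ) : Prop :=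
  ∀ ε > 0, ∃ δ : ℝ × ℝ → ℝ, (∀ p, 0 < δ p) ∧
    ∀ (n m : ℕ) (x y : ℕ → ℝ) (ξ η : ℕ → ℕ → ℝ),
      IsPartition x y n m a b c d → Tags x y ξ η n m → KHFine δ x y ξ η n m →
      |KHSum f x y ξ η n m - A| < ε

/-- Kurzweil–Henstock integrability of a complex-valued function, via components. -/
def KHIntegralOnC (f : ℝ → ℝ → ℂ) (a b c d : ℝ) (A : ℂ) : Prop :=
  KHIntegralOn (fun s t => (f s t).re) a b c d A.re ∧
  KHIntegralOn (fun s t => (f s t).im) a b c d A.im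

/-- Pringsheim limit, over expanding compact rectangles, of Kurzweil–Henstock integrals. -/
def HasKHPringsheim (f : ℝ → ℝ → ℝ) (A : ℝ) : Prop :=
  ∀ ε > 0, ∃ M : ℝ, ∀ a b c d : ℝ, a ≤ -M → M ≤ b → c ≤ -M → M ≤ d →
    ∃ B : ℝ, KHIntegralOn f a b c d B ∧ |B - A| < ε

/-- Complex-valued Pringsheim limit of Kurzweil–Henstock integrals. -/
def HasKHPringsheimC (f : ℝ → ℝ → ℂ) (A : ℂ) : Prop :=
  ∀ ε > 0, ∃ M : ℝ, ∀ a b c d : ℝ, a ≤ -M → M ≤ b → c ≤ -M → M ≤ d →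
    ∃ B : ℂ, KHIntegralOnC f a b c d B ∧ ‖B - A‖ < ε

/-- The kernel `e^{-i(ξ t₁ + η t₂)}`. -/
def fourierKernel (ξ η t₁ t₂ : ℝ) : ℂ :=
  Complex.exp (-Complex.I * ((ξ * t₁ + η * t₂ : ℝ) : ℂ))

/-- `A` is the KP-Fourier transform of `f` at `(ξ, η)`. -/
def HasKPFourier (f : ℝ → ℝ → ℝ) (ξ η : ℝ) (A : ℂ) : Prop :=
  HasKHPringsheimC (fun t₁ t₂ => (f t₁ t₂ : ℂ) * fourierKernel ξ η t₁ t₂) A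

/-- The region `{(ξ,η) : α₁ ≤ |ξ| ≤ β₁, α₂ ≤ |η| ≤ β₂}`. -/
def annulusRect (α₁ β₁ α₂ β₂ : ℝ) : Set (ℝ × ℝ) :=
  {p | α₁ ≤ |p.1| ∧ |p.1| ≤ β₁ ∧ α₂ ≤ |p.2| ∧ |p.2| ≤ β₂}

/-- The kernel `(sin(βt) - sin(αt))/t`, extended by continuity at `t = 0`. -/
def sinKernel (α β t : ℝ) : ℝ :=
  if t = 0 then β - α else (Real.sin (β * t) - Real.sin (α * t)) / t

/-- The kernel `h_{α,β}(t) = (sin(βt) - sin(αt))/(πt)`, extended by continuity at `t = 0`. -/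
def sinKernelPi (α β t : ℝ) : ℝ :=
  if t = 0 then (β - α) / π else (Real.sin (β * t) - Real.sin (α * t)) / (π * t)

/-- `g_{(x,y)}(t₁,t₂) = f(x−t₁,y−t₂) + f(x−t₁,y+t₂) + f(x+t₁,y−t₂) + f(x+t₁,y+t₂)`. -/
def quadSum (f : ℝ → ℝ → ℝ) (x y t₁ t₂ : ℝ) : ℝ :=
  f (x - t₁) (y - t₂) + f (x - t₁) (y + t₂) + f (x + t₁) (y - t₂) + f (x + t₁) (y + t₂)

namespace Stmt9Aux

/-- Rectangular increment. -/
def D (f : ℝ → ℝ → ℝ) (p q r s : ℝ) : ℝ := f q s - f p s - f q r + f p r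

/-- Chains of points, recorded through their cost functional. -/
inductive Ch : ℝ → ℝ → ((ℝ → ℝ → ℝ) → ℝ) → Prop
  | nil (a : ℝ) : Ch a a (fun _ => 0)
  | snoc {a b c : ℝ} {S : (ℝ → ℝ → ℝ) → ℝ} : Ch a b S → b < c → Ch a c (fun φ => S φ + φ b c)

/-- Nonnegative cost with the triangle inequality. -/
structure PM (φ : ℝ → ℝ → ℝ) : Prop where
  nonneg : ∀ a b, 0 ≤ φ a b
  self : ∀ a, φ a a = 0
  tri : ∀ a b c, φ a c ≤ φ a b + φ b c

theorem Ch.le {a b S} (h : Ch a b S) : a ≤ b := by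
  induction h with
  | nil => exact le_rfl
  | snoc _ h ih => exact ih.trans h.le

theorem Ch.seq {a b S} (h : Ch a b S) : ∃ (n : ℕ) (x : ℕ → ℝ), x 0 = a ∧ x n = b ∧
    (∀ i < n, x i < x (i+1)) ∧ ∀ φ, S φ = ∑ i ∈ Finset.range n, φ (x i) (x (i+1)) := by
  induction h with
  | nil => exact ⟨0, fun _ => a, rfl, rfl, by simp, by simp⟩
  | @snoc b c S _ hbc ih =>
    obtain ⟨n, x, h0, hn, hs, hS⟩ := ih
    refine ⟨n+1, fun i => if i ≤ n then x i else c, by simpa using h0, by simp, ?_, ?_⟩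
    · intro i hi
      rcases Nat.lt_succ_iff_lt_or_eq.mp hi with h | h
      · have h1 : i ≤ n := h.le
        have h2 : i + 1 ≤ n := h
        simp only [h1, h2, if_true]; exact hs i h
      · subst h; simp [hn, hbc]
    · intro φ
      rw [Finset.sum_range_succ]
      dsimp only
      rw [hS]
      congr 1
      · refine Finset.sum_congr rfl fun i hi => ?_
        have h := Finset.mem_range.mp hi
        have h1 : i ≤ n := h.le
        have h2 : i + 1 ≤ n := h
        simp only [h1, h2, if_true]
      · simp [hn]

theorem Ch.of_seq (n : ℕ) (x : ℕ → ℝ) (h : ∀ i < n, x i < x (i+1)) :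
    Ch (x 0) (x n) (fun φ => ∑ i ∈ Finset.range n, φ (x i) (x (i+1))) := by
  induction n with
  | zero => simpa using Ch.nil (x 0)
  | succ n ih =>
    have := Ch.snoc (ih fun i hi => h i (by omega)) (h n (by omega))
    simpa [Finset.sum_range_succ] using this

theorem Ch.trans {a b c S T} (h : Ch a b S) (h' : Ch b c T) : Ch a c (fun φ => S φ + T φ) := by
  induction h' with
  | nil => simpa using h
  | snoc _ hbc ih =>
    have := Ch.snoc ih hbc
    simpa [add_assoc] using this

theorem Ch.single {a b : ℝ} (h : a ≤ b) : ∃ S, Ch a b S ∧ ∀ φ, PM φ → 0 ≤ S φ := by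
  rcases h.eq_or_lt with h | h
  · subst h; exact ⟨_, Ch.nil a, fun φ _ => le_rfl⟩
  · exact ⟨_, Ch.snoc (Ch.nil a) h, fun φ hφ => by simpa using hφ.nonneg a b⟩

theorem Ch.tri {a b S} (h : Ch a b S) (φ) (hφ : PM φ) : φ a b ≤ S φ := by
  induction h with
  | nil => simp [hφ.self]
  | snoc _ _ ih => exact (hφ.tri _ _ _).trans (add_le_add_left ih _)

theorem Ch.split {a c U} (h : Ch a c U) : ∀ b, a ≤ b → b ≤ c → ∃ U₁ U₂, Ch a b U₁ ∧ Ch b c U₂ ∧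
    ∀ φ, PM φ → U φ ≤ U₁ φ + U₂ φ := by
  induction h with
  | nil =>
    intro b h1 h2
    obtain rfl := le_antisymm h1 h2
    exact ⟨_, _, Ch.nil a, Ch.nil a, by simp⟩
  | @snoc c' c S hc hlt ih =>
    intro b h1 h2
    rcases le_or_gt b c' with h | h
    · obtain ⟨U₁, U₂, k1, k2, k3⟩ := ih b h1 h
      exact ⟨_, _, k1, Ch.snoc k2 hlt, fun φ hφ => by have := k3 φ hφ; dsimp; linarith⟩
    · rcases h2.eq_or_lt with e | e
      · subst e
        exact ⟨_, _, Ch.snoc hc h, Ch.nil b, by simp⟩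
      · refine ⟨_, _, Ch.snoc hc h, Ch.snoc (Ch.nil b) e, fun φ hφ => ?_⟩
        have := hφ.tri c' b c
        dsimp; linarith

theorem Ch.refine {a b S} (h : Ch a b S) : ∀ U, Ch a b U → ∃ T, Ch a b T ∧
    ∀ φ, PM φ → S φ ≤ T φ ∧ U φ ≤ T φ := by
  induction h with
  | nil => exact fun U hU => ⟨U, hU, fun φ hφ => ⟨by simpa [hφ.self] using hU.tri φ hφ, le_rfl⟩⟩
  | @snoc b c S hb hlt ih =>
    intro U hU
    obtain ⟨U₁, U₂, k1, k2, k3⟩ := hU.split b hb.le hlt.le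
    obtain ⟨T, hT, hT'⟩ := ih U₁ k1
    refine ⟨_, hT.trans k2, fun φ hφ => ?_⟩
    have h1 := hT' φ hφ
    have h2 := k3 φ hφ
    have h3 := k2.tri φ hφ
    constructor <;> linarith [h1.1, h1.2]

/-- Two chains, refined and split at `p`. -/
theorem chains (n₁ n₂ : ℕ) (x₁ x₂ : ℕ → ℝ) (h₁ : ∀ i < n₁, x₁ i < x₁ (i+1))
    (h₂ : ∀ i < n₂, x₂ i < x₂ (i+1)) (p q : ℝ) (hpq : p ≤ q) (hp : x₁ n₁ ≤ p) (hq : x₂ n₂ ≤ q) :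
    ∃ (a : ℝ) (S T : (ℝ → ℝ → ℝ) → ℝ), Ch a p S ∧ Ch p q T ∧ ∀ φ, PM φ →
      ∑ i ∈ Finset.range n₁, φ (x₁ i) (x₁ (i+1)) ≤ S φ ∧
      ∑ i ∈ Finset.range n₂, φ (x₂ i) (x₂ (i+1)) ≤ S φ + T φ := by
  have c1 := Ch.of_seq n₁ x₁ h₁
  have c2 := Ch.of_seq n₂ x₂ h₂
  obtain ⟨A1, a1, b1⟩ := Ch.single (min_le_left (x₁ 0) (x₂ 0))
  obtain ⟨A2, a2, b2⟩ := Ch.single (min_le_right (x₁ 0) (x₂ 0))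
  obtain ⟨A3, a3, b3⟩ := Ch.single hp
  obtain ⟨A4, a4, b4⟩ := Ch.single hq
  have d1 := (a1.trans c1).trans a3
  have d2 := (a2.trans c2).trans a4
  obtain ⟨U₁, U₂, k1, k2, k3⟩ := d2.split p d1.le hpq
  obtain ⟨T, hT, hT'⟩ := d1.refine U₁ k1
  refine ⟨_, T, U₂, hT, k2, fun φ hφ => ?_⟩
  have := hT' φ hφ
  have := k3 φ hφ
  have := b1 φ hφ
  have := b2 φ hφ
  have := b3 φ hφ
  have := b4 φ hφ
  constructor <;> linarith [(hT' φ hφ).1, (hT' φ hφ).2]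

theorem Ch.mono {a b S} (h : Ch a b S) {φ ψ : ℝ → ℝ → ℝ} (hl : ∀ s t, φ s t ≤ ψ s t) :
    S φ ≤ S ψ := by
  obtain ⟨n, x, -, -, -, h⟩ := h.seq
  rw [h, h]; exact Finset.sum_le_sum fun i _ => hl _ _

theorem Ch.add {a b S} (h : Ch a b S) (φ ψ : ℝ → ℝ → ℝ) :
    S (fun s t => φ s t + ψ s t) = S φ + S ψ := by
  obtain ⟨n, x, -, -, -, h⟩ := h.seq
  rw [h, h, h, Finset.sum_add_distrib]

theorem Ch.nonneg {a b S} (h : Ch a b S) {φ : ℝ → ℝ → ℝ} (hl : ∀ s t, 0 ≤ φ s t) :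
    0 ≤ S φ := by
  obtain ⟨n, x, -, -, -, h⟩ := h.seq
  rw [h]; exact Finset.sum_nonneg fun i _ => hl _ _

theorem Ch.zero {a b S} (h : Ch a b S) : S (fun _ _ => 0) = 0 := by
  obtain ⟨n, x, -, -, -, h⟩ := h.seq
  rw [h]; simp

theorem pm_y (f : ℝ → ℝ → ℝ) (p q : ℝ) : PM (fun r s => |D f p q r s|) where
  nonneg _ _ := abs_nonneg _
  self a := by simp [D]
  tri a b c := by
    have : D f p q a c = D f p q a b + D f p q b c := by simp only [D]; ring
    rw [this]; exact abs_add_le _ _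

theorem pm_x (f : ℝ → ℝ → ℝ) {a b T} (h : Ch a b T) :
    PM (fun p q => T (fun r s => |D f p q r s|)) where
  nonneg _ _ := h.nonneg fun _ _ => abs_nonneg _
  self a := by simpa [D] using h.zero
  tri a b c := by
    rw [← h.add]
    refine h.mono fun r s => ?_
    have : D f a c r s = D f a b r s + D f b c r s := by simp only [D]; ring
    rw [this]; exact abs_add_le _ _

/-- The variation function. -/
def V (f : ℝ → ℝ → ℝ) (p q : ℝ) : ℝ := (vitaliVar f (Set.Iic p ×ˢ Set.Iic q)).toReal

theorem vitaliVar_mono (f : ℝ → ℝ → ℝ) {Q Q' : Set (ℝ × ℝ)} (h : Q ⊆ Q') :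
    vitaliVar f Q ≤ vitaliVar f Q' := by
  unfold vitaliVar
  refine iSup_le fun n => iSup_le fun m => iSup_le fun x => iSup_le fun y => iSup_le fun hx =>
    iSup_le fun hy => iSup_le fun hQ => ?_
  exact le_iSup_of_le n <| le_iSup_of_le m <| le_iSup_of_le x <| le_iSup_of_le y <|
    le_iSup_of_le hx <| le_iSup_of_le hy <| le_iSup_of_le (hQ.trans h) le_rfl

theorem V_le_K {f : ℝ → ℝ → ℝ} (hf : BVV f) (p q : ℝ) :
    V f p q ≤ (vitaliVar f Set.univ).toReal :=
  ENNReal.toReal_mono (ne_of_lt hf) (vitaliVar_mono f (Set.subset_univ _))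

theorem V_nonneg (f : ℝ → ℝ → ℝ) (p q : ℝ) : 0 ≤ V f p q := ENNReal.toReal_nonneg

theorem le_V {f : ℝ → ℝ → ℝ} (hf : BVV f) {a b c d p q S T} (hS : Ch a b S) (hT : Ch c d T)
    (hb : b ≤ p) (hd : d ≤ q) :
    S (fun p q => T (fun r s => |D f p q r s|)) ≤ V f p q := by
  obtain ⟨n, x, -, rfl, hx, h⟩ := hS.seq
  obtain ⟨m, y, -, rfl, hy, h'⟩ := hT.seq
  have e : S (fun p q => T (fun r s => |D f p q r s|)) = vitaliSum f x y n m := by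
    rw [h]; simp only [h', vitaliSum, D]
  rw [e]
  unfold V
  have hlt : vitaliVar f (Set.Iic p ×ˢ Set.Iic q) ≠ ⊤ :=
    ne_of_lt (lt_of_le_of_lt (vitaliVar_mono f (Set.subset_univ _)) hf)
  rw [← ENNReal.ofReal_le_iff_le_toReal hlt]
  unfold vitaliVar
  refine le_iSup_of_le n <| le_iSup_of_le m <| le_iSup_of_le x <| le_iSup_of_le y <|
    le_iSup_of_le hx <| le_iSup_of_le hy <| le_iSup_of_le ?_ le_rfl
  rintro ⟨u, v⟩ ⟨hu, hv⟩
  exact ⟨hu.2.trans hb, hv.2.trans hd⟩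

theorem V_le {f : ℝ → ℝ → ℝ} {p q C : ℝ} (hC : 0 ≤ C)
    (h : ∀ (n m : ℕ) (x y : ℕ → ℝ), (∀ i < n, x i < x (i+1)) → (∀ j < m, y j < y (j+1)) →
      x n ≤ p → y m ≤ q → vitaliSum f x y n m ≤ C) : V f p q ≤ C := by
  unfold V
  refine ENNReal.toReal_le_of_le_ofReal hC ?_
  unfold vitaliVar
  refine iSup_le fun n => iSup_le fun m => iSup_le fun x => iSup_le fun y => iSup_le fun hx =>
    iSup_le fun hy => iSup_le fun hQ => ENNReal.ofReal_le_ofReal ?_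
  have h1 := (Ch.of_seq n x hx).le
  have h2 := (Ch.of_seq m y hy).le
  have h3 := hQ (show (x n, y m) ∈ Set.Icc (x 0) (x n) ×ˢ Set.Icc (y 0) (y m) from
    ⟨⟨h1, le_rfl⟩, ⟨h2, le_rfl⟩⟩)
  exact h n m x y hx hy h3.1 h3.2

theorem two_grids {f : ℝ → ℝ → ℝ} (hf : BVV f) {p q r s : ℝ} (hpq : p ≤ q) (hrs : r ≤ s)
    (n₁ m₁ : ℕ) (x₁ y₁ : ℕ → ℝ) (hx₁ : ∀ i < n₁, x₁ i < x₁ (i+1)) (hy₁ : ∀ j < m₁, y₁ j < y₁ (j+1))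
    (hp : x₁ n₁ ≤ p) (hs : y₁ m₁ ≤ s)
    (n₂ m₂ : ℕ) (x₂ y₂ : ℕ → ℝ) (hx₂ : ∀ i < n₂, x₂ i < x₂ (i+1)) (hy₂ : ∀ j < m₂, y₂ j < y₂ (j+1))
    (hq : x₂ n₂ ≤ q) (hr : y₂ m₂ ≤ r) :
    vitaliSum f x₁ y₁ n₁ m₁ + vitaliSum f x₂ y₂ n₂ m₂ + |D f p q r s| ≤ V f q s + V f p r := by
  obtain ⟨a, X1, X2, cX1, cX2, hX⟩ := chains n₁ n₂ x₁ x₂ hx₁ hx₂ p q hpq hp hq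
  obtain ⟨c, Y1, Y2, cY1, cY2, hY⟩ := chains m₂ m₁ y₂ y₁ hy₂ hy₁ r s hrs hr hs
  have e1 := le_V hf (cX1.trans cX2) (cY1.trans cY2) le_rfl le_rfl
  have e2 := le_V hf cX1 cY1 le_rfl le_rfl
  have e3 := cX2.tri _ (pm_x f cY2)
  have e4 := cY2.tri _ (pm_y f p q)
  have e5 : vitaliSum f x₁ y₁ n₁ m₁ ≤ X1 (fun p q => Y1 (fun r s => |D f p q r s|)) +
      X1 (fun p q => Y2 (fun r s => |D f p q r s|)) := by
    rw [← cX1.add]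
    refine le_trans ?_ (hX _ (pm_x f (cY1.trans cY2))).1
    exact Finset.sum_le_sum fun i _ => (hY _ (pm_y f _ _)).2
  have e6 : vitaliSum f x₂ y₂ n₂ m₂ ≤ X1 (fun p q => Y1 (fun r s => |D f p q r s|)) +
      X2 (fun p q => Y1 (fun r s => |D f p q r s|)) := by
    refine le_trans ?_ (hX _ (pm_x f cY1)).2
    exact Finset.sum_le_sum fun i _ => (hY _ (pm_y f _ _)).1
  rw [cX1.add, cX2.add] at e1
  linarith

/-- Domination of the increments of `f` by those of `V`. -/
theorem dom_V {f : ℝ → ℝ → ℝ} (hf : BVV f) {p q r s : ℝ} (hpq : p ≤ q) (hrs : r ≤ s) :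
    |D f p q r s| ≤ D (V f) p q r s := by
  have key : ∀ (n₁ m₁ : ℕ) (x₁ y₁ : ℕ → ℝ), (∀ i < n₁, x₁ i < x₁ (i+1)) →
      (∀ j < m₁, y₁ j < y₁ (j+1)) → x₁ n₁ ≤ p → y₁ m₁ ≤ s →
      vitaliSum f x₁ y₁ n₁ m₁ ≤ V f q s + V f p r - |D f p q r s| - V f q r := by
    intro n₁ m₁ x₁ y₁ h1 h2 h3 h4
    have : V f q r ≤ V f q s + V f p r - |D f p q r s| - vitaliSum f x₁ y₁ n₁ m₁ := by
      refine V_le ?_ ?_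
      · have := two_grids hf hpq hrs n₁ m₁ x₁ y₁ h1 h2 h3 h4 0 0 (fun _ => q) (fun _ => r)
          (by simp) (by simp) le_rfl le_rfl
        have h0 : vitaliSum f (fun _ => q) (fun _ => r) 0 0 = 0 := by simp [vitaliSum]
        linarith
      · intro n m x y k1 k2 k3 k4
        have := two_grids hf hpq hrs n₁ m₁ x₁ y₁ h1 h2 h3 h4 n m x y k1 k2 k3 k4
        linarith
    linarith
  have : V f p s ≤ V f q s + V f p r - |D f p q r s| - V f q r := by
    refine V_le ?_ key
    have := key 0 0 (fun _ => p) (fun _ => s) (by simp) (by simp) le_rfl le_rfl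
    have h0 : vitaliSum f (fun _ => p) (fun _ => s) 0 0 = 0 := by simp [vitaliSum]
    linarith
  have e : D (V f) p q r s = V f q s - V f p s - V f q r + V f p r := rfl
  rw [e]; linarith

theorem tele2 (f : ℝ → ℝ → ℝ) (w z : ℕ → ℝ) (n m : ℕ) :
    ∑ k ∈ Finset.range n, ∑ l ∈ Finset.range m, D f (w k) (w (k+1)) (z l) (z (l+1))
      = D f (w 0) (w n) (z 0) (z m) := by
  have h1 : ∀ p q, ∑ l ∈ Finset.range m, D f p q (z l) (z (l+1)) = D f p q (z 0) (z m) := by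
    intro p q
    have := Finset.sum_range_sub (fun l => f q (z l) - f p (z l)) m
    rw [show D f p q (z 0) (z m) = (f q (z m) - f p (z m)) - (f q (z 0) - f p (z 0)) by
      simp only [D]; ring, ← this]
    exact Finset.sum_congr rfl fun l _ => by simp only [D]; ring
  simp only [h1]
  have := Finset.sum_range_sub (fun k => f (w k) (z m) - f (w k) (z 0)) n
  rw [show D f (w 0) (w n) (z 0) (z m) = (f (w n) (z m) - f (w n) (z 0)) -
      (f (w 0) (z m) - f (w 0) (z 0)) by simp only [D]; ring, ← this]
  exact Finset.sum_congr rfl fun l _ => by simp only [D]; ring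

theorem DV_le {f : ℝ → ℝ → ℝ} (hf : BVV f) (p q r s : ℝ) :
    D (V f) p q r s ≤ 2 * (vitaliVar f Set.univ).toReal := by
  have h1 := V_le_K hf q s
  have h2 := V_le_K hf p r
  have h3 := V_nonneg f p s
  have h4 := V_nonneg f q r
  simp only [D]; linarith

theorem BVV_V {f : ℝ → ℝ → ℝ} (hf : BVV f) : BVV (V f) := by
  unfold BVV
  refine lt_of_le_of_lt (b := ENNReal.ofReal (2 * (vitaliVar f Set.univ).toReal)) ?_
    ENNReal.ofReal_lt_top
  unfold vitaliVar
  refine iSup_le fun n => iSup_le fun m => iSup_le fun x => iSup_le fun y => iSup_le fun hx =>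
    iSup_le fun hy => iSup_le fun _ => ENNReal.ofReal_le_ofReal ?_
  have : vitaliSum (V f) x y n m = D (V f) (x 0) (x n) (y 0) (y m) := by
    rw [← tele2]
    refine Finset.sum_congr rfl fun i hi => Finset.sum_congr rfl fun j hj => abs_of_nonneg ?_
    exact (abs_nonneg _).trans
      (dom_V hf (hx i (Finset.mem_range.mp hi)).le (hy j (Finset.mem_range.mp hj)).le)
  rw [this]
  exact DV_le hf _ _ _ _

/-- Clamping to `[p,q]`. -/
def cl (p q u : ℝ) : ℝ := max p (min q u)

theorem cl_lo {p q u : ℝ} (h : p ≤ q) (hu : u ≤ p) : cl p q u = p := by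
  unfold cl; rw [min_eq_right (hu.trans h), max_eq_left hu]

theorem cl_hi {p q u : ℝ} (h : p ≤ q) (hu : q ≤ u) : cl p q u = q := by
  unfold cl; rw [min_eq_left hu, max_eq_right h]

theorem cl_mono (p q : ℝ) {u v : ℝ} (h : u ≤ v) : cl p q u ≤ cl p q v :=
  max_le_max le_rfl (min_le_min le_rfl h)

theorem le_cl (p q u : ℝ) : p ≤ cl p q u := le_max_left _ _

theorem cl_le {p q : ℝ} (h : p ≤ q) (u : ℝ) : cl p q u ≤ q := max_le h (min_le_left _ _)

theorem cl_swap {p q u v : ℝ} (h : p ≤ q) (h' : u ≤ v) :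
    (cl p q u = cl u v p ∧ cl p q v = cl u v q ∧ ∃ t, t ∈ Icc p q ∧ t ∈ Icc u v) ∨
    (cl p q u = cl p q v ∧ cl u v p = cl u v q) := by
  rcases le_or_gt v p with h1 | h1
  · right
    rw [cl_lo h (h'.trans h1), cl_lo h h1, cl_hi h' h1, cl_hi h' (h1.trans h)]; simp
  rcases le_or_gt q u with h2 | h2
  · right
    rw [cl_hi h h2, cl_hi h (h2.trans h'), cl_lo h' (h.trans h2), cl_lo h' h2]; simp
  left
  refine ⟨?_, ?_, max p u, ⟨le_max_left _ _, max_le h h2.le⟩, ⟨le_max_right _ _, max_le h1.le h'⟩⟩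
  · unfold cl; rw [min_eq_right h2.le, min_eq_right h1.le, max_comm]
  · unfold cl; rw [max_eq_right (le_min h h1.le), max_eq_right (le_min h' h2.le), min_comm]

/-- `W` dominates the increments of `f`. -/
def Dom (f W : ℝ → ℝ → ℝ) : Prop :=
  ∀ p q r s, p ≤ q → r ≤ s → |D f p q r s| ≤ D W p q r s

theorem Dom.nonneg {f W} (h : Dom f W) {p q r s} (h1 : p ≤ q) (h2 : r ≤ s) : 0 ≤ D W p q r s :=
  (abs_nonneg _).trans (h p q r s h1 h2)

theorem Dom.self {f W} (h : Dom f W) : Dom W W := fun _ _ _ _ h1 h2 =>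
  (abs_of_nonneg (h.nonneg h1 h2)).le

theorem Dom.sub {f W} (h : Dom f W) {p p1 q1 q r r1 s1 s : ℝ} (h1 : p ≤ p1) (h2 : p1 ≤ q1)
    (h3 : q1 ≤ q) (h4 : r ≤ r1) (h5 : r1 ≤ s1) (h6 : s1 ≤ s) :
    |D f p q r s - D f p1 q1 r1 s1| ≤ D W p q r s - D W p1 q1 r1 s1 := by
  have e : ∀ F : ℝ → ℝ → ℝ, D F p q r s - D F p1 q1 r1 s1 =
    D F p p1 r s + D F q1 q r s + D F p1 q1 r r1 + D F p1 q1 s1 s := by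
    intro F; simp only [D]; ring
  rw [e, e]
  have h46 := (h4.trans h5).trans h6
  have a1 := abs_le.mp (h p p1 r s h1 h46)
  have a2 := abs_le.mp (h q1 q r s h3 h46)
  have a3 := abs_le.mp (h p1 q1 r r1 h2 h4)
  have a4 := abs_le.mp (h p1 q1 s1 s h2 h6)
  rw [abs_le]
  constructor <;> linarith [a1.1, a1.2, a2.1, a2.2, a3.1, a3.2, a4.1, a4.2]

theorem abs_key {α β : Type*} (s : Finset α) (t : Finset β) (G : α → ℝ) (G' : β → ℝ)
    (w v : α → β → ℝ) (A Av : α → ℝ) (B Bv : β → ℝ) (ε C : ℝ)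
    (hA : ∀ a ∈ s, A a = ∑ b ∈ t, w a b) (hAv : ∀ a ∈ s, Av a = ∑ b ∈ t, v a b)
    (hc : ∀ a ∈ s, ∀ b ∈ t, |(G a - G' b) * w a b| ≤ ε * v a b)
    (hC : ∀ b ∈ t, |G' b| ≤ C)
    (hB : ∀ b ∈ t, |B b - ∑ a ∈ s, w a b| ≤ Bv b - ∑ a ∈ s, v a b) :
    |∑ a ∈ s, G a * A a - ∑ b ∈ t, G' b * B b| ≤
      ε * ∑ a ∈ s, Av a + C * (∑ b ∈ t, Bv b - ∑ a ∈ s, Av a) := by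
  have e1 : ∑ a ∈ s, G a * A a - ∑ b ∈ t, G' b * B b =
      ∑ a ∈ s, ∑ b ∈ t, (G a - G' b) * w a b -
        ∑ b ∈ t, G' b * (B b - ∑ a ∈ s, w a b) := by
    have h1 : ∑ a ∈ s, G a * A a = ∑ a ∈ s, ∑ b ∈ t, G a * w a b :=
      Finset.sum_congr rfl fun a ha => by rw [hA a ha, Finset.mul_sum]
    have h2 : ∑ b ∈ t, G' b * (∑ a ∈ s, w a b) = ∑ a ∈ s, ∑ b ∈ t, G' b * w a b := by
      rw [Finset.sum_comm]
      exact Finset.sum_congr rfl fun a ha => by rw [Finset.mul_sum]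
    simp only [sub_mul, mul_sub, Finset.sum_sub_distrib]
    rw [h1, h2]; ring
  have e2 : ∑ a ∈ s, Av a = ∑ a ∈ s, ∑ b ∈ t, v a b := Finset.sum_congr rfl hAv
  rw [e1]
  refine (abs_sub _ _).trans (add_le_add ?_ ?_)
  · rw [e2, Finset.mul_sum]
    refine (Finset.abs_sum_le_sum_abs _ _).trans (Finset.sum_le_sum fun a ha => ?_)
    rw [Finset.mul_sum]
    exact (Finset.abs_sum_le_sum_abs _ _).trans (Finset.sum_le_sum fun b hb => hc a ha b hb)
  · rw [e2, Finset.sum_comm, ← Finset.sum_sub_distrib, Finset.mul_sum]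
    refine (Finset.abs_sum_le_sum_abs _ _).trans (Finset.sum_le_sum fun b hb => ?_)
    rw [abs_mul]
    exact mul_le_mul (hC b hb) (hB b hb) (abs_nonneg _) ((abs_nonneg _).trans (hC b hb))

/-- Weak partition of `[a,b]` with mesh less than `δ`. -/
structure WP (x : ℕ → ℝ) (n : ℕ) (a b δ : ℝ) : Prop where
  fst : x 0 = a
  lst : x n = b
  step : ∀ i < n, x i ≤ x (i+1)
  mesh : ∀ i < n, x (i+1) - x i < δ

theorem WP.mono {x n a b δ} (h : WP x n a b δ) : ∀ j ≤ n, ∀ i ≤ j, x i ≤ x j := by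
  intro j
  induction j with
  | zero => intro _ i hi; simp [Nat.le_zero.mp hi]
  | succ j ih =>
    intro hj i hi
    rcases Nat.of_le_succ hi with h' | h'
    · exact (ih (by omega) i h').trans (h.step j (by omega))
    · rw [h']

theorem WP.ge {x n a b δ} (h : WP x n a b δ) {i} (hi : i ≤ n) : a ≤ x i :=
  h.fst ▸ h.mono i hi 0 (Nat.zero_le _)

theorem WP.le {x n a b δ} (h : WP x n a b δ) {i} (hi : i ≤ n) : x i ≤ b :=
  h.lst ▸ h.mono n le_rfl i hi

theorem WP.exists {a b δ : ℝ} (hab : a ≤ b) (hδ : 0 < δ) : ∃ n x, WP x n a b δ := by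
  obtain ⟨n, hn⟩ := exists_nat_gt ((b - a) / δ)
  have hn0 : (0:ℝ) < n := lt_of_le_of_lt (div_nonneg (by linarith) hδ.le) hn
  have h1 : (b - a) / n < δ := by
    rw [div_lt_iff₀ hδ] at hn
    rw [div_lt_iff₀ hn0]; linarith
  have h2 : 0 ≤ (b - a) / n := div_nonneg (by linarith) hn0.le
  refine ⟨n, fun i => a + i * ((b - a) / n), by simp, by field_simp; ring, ?_, ?_⟩
  · intro i _; push_cast; nlinarith
  · intro i _; push_cast; linarith

/-- uniform continuity at scale `δ` on a rectangle -/
def UC (g : ℝ → ℝ → ℝ) (a b c d ε δ : ℝ) : Prop :=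
  ∀ s ∈ Icc a b, ∀ t ∈ Icc c d, ∀ s' ∈ Icc a b, ∀ t' ∈ Icc c d,
    |s - s'| < 2 * δ → |t - t'| < 2 * δ → |g s t - g s' t'| ≤ ε

theorem UC.exists {g : ℝ → ℝ → ℝ} (hg : Continuous fun p : ℝ × ℝ => g p.1 p.2) (a b c d : ℝ)
    {ε : ℝ} (hε : 0 < ε) : ∃ δ > 0, UC g a b c d ε δ := by
  have hK : IsCompact (Icc a b ×ˢ Icc c d) := isCompact_Icc.prod isCompact_Icc
  have := hK.uniformContinuousOn_of_continuous hg.continuousOn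
  rw [Metric.uniformContinuousOn_iff] at this
  obtain ⟨δ, hδ, h⟩ := this ε hε
  refine ⟨δ / 2, by positivity, ?_⟩
  intro s hs t ht s' hs' t' ht' h1 h2
  have := h (s, t) ⟨hs, ht⟩ (s', t') ⟨hs', ht'⟩ (by
    rw [Prod.dist_eq, Real.dist_eq, Real.dist_eq]
    exact max_lt (by simpa [mul_div_cancel₀] using h1) (by simpa [mul_div_cancel₀] using h2))
  rw [Real.dist_eq] at this
  exact this.le

theorem RSSum_eq (g f x y ξ η n m) : RSSum g f x y ξ η n m =
    ∑ a ∈ Finset.range n ×ˢ Finset.range m, g (ξ a.1 a.2) (η a.1 a.2) *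
      D f (x a.1) (x (a.1+1)) (y a.2) (y (a.2+1)) := by
  rw [Finset.sum_product]; rfl

/-- Comparison of two Riemann-Stieltjes sums on nested rectangles. -/
theorem key {g f W : ℝ → ℝ → ℝ} (hd : Dom f W) {C : ℝ} (hC : ∀ s t, |g s t| ≤ C)
    {a b c d a' b' c' d' ε δ δ₁ δ₂ : ℝ} (ha : a' ≤ a) (hab : a ≤ b) (hb : b ≤ b') (hc : c' ≤ c)
    (hcd : c ≤ d) (hd' : d ≤ d') (hu : UC g a' b' c' d' ε δ) (hδ₁ : δ₁ ≤ δ) (hδ₂ : δ₂ ≤ δ)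
    {n m : ℕ} {x y : ℕ → ℝ} {ξ η : ℕ → ℕ → ℝ} (hx : WP x n a b δ₁) (hy : WP y m c d δ₁)
    (ht : Tags x y ξ η n m)
    {n' m' : ℕ} {x' y' : ℕ → ℝ} {ξ' η' : ℕ → ℕ → ℝ} (hx' : WP x' n' a' b' δ₂)
    (hy' : WP y' m' c' d' δ₂) (ht' : Tags x' y' ξ' η' n' m') :
    |RSSum g f x y ξ η n m - RSSum g f x' y' ξ' η' n' m'| ≤
      ε * D W a b c d + C * (D W a' b' c' d' - D W a b c d) := by
  have tot : ∀ (F : ℝ → ℝ → ℝ) (x y : ℕ → ℝ) (n m : ℕ),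
      ∑ a ∈ Finset.range n ×ˢ Finset.range m, D F (x a.1) (x (a.1+1)) (y a.2) (y (a.2+1)) =
      D F (x 0) (x n) (y 0) (y m) := by
    intro F x y n m; rw [Finset.sum_product]; exact tele2 F x y n m
  -- the pieces
  set pc : (ℝ → ℝ → ℝ) → ℕ × ℕ → ℕ × ℕ → ℝ := fun F i k =>
    D F (cl (x i.1) (x (i.1+1)) (x' k.1)) (cl (x i.1) (x (i.1+1)) (x' (k.1+1)))
      (cl (y i.2) (y (i.2+1)) (y' k.2)) (cl (y i.2) (y (i.2+1)) (y' (k.2+1))) with hpc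
  have sym : ∀ (F : ℝ → ℝ → ℝ) (i k : ℕ × ℕ), i ∈ Finset.range n ×ˢ Finset.range m →
      k ∈ Finset.range n' ×ˢ Finset.range m' → pc F i k =
      D F (cl (x' k.1) (x' (k.1+1)) (x i.1)) (cl (x' k.1) (x' (k.1+1)) (x (i.1+1)))
      (cl (y' k.2) (y' (k.2+1)) (y i.2)) (cl (y' k.2) (y' (k.2+1)) (y (i.2+1))) := by
    intro F i k hi hk
    simp only [Finset.mem_product, Finset.mem_range] at hi hk
    rcases cl_swap (hx.step _ hi.1) (hx'.step _ hk.1) with ⟨e1, e2, -⟩ | ⟨e1, e2⟩ <;>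
    rcases cl_swap (hy.step _ hi.2) (hy'.step _ hk.2) with ⟨e3, e4, -⟩ | ⟨e3, e4⟩
    · simp only [hpc, e1, e2, e3, e4]
    · simp only [hpc, e1, e2, e3, e4, D]; ring
    · simp only [hpc, e1, e2, e3, e4, D]; ring
    · simp only [hpc, e1, e2, e3, e4, D]; ring
  have s1 : ∀ F, ∀ i ∈ Finset.range n ×ˢ Finset.range m,
      D F (x i.1) (x (i.1+1)) (y i.2) (y (i.2+1)) =
      ∑ k ∈ Finset.range n' ×ˢ Finset.range m', pc F i k := by
    intro F i hi
    simp only [Finset.mem_product, Finset.mem_range] at hi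
    have := tot F (fun k => cl (x i.1) (x (i.1+1)) (x' k)) (fun k => cl (y i.2) (y (i.2+1)) (y' k))
      n' m'
    rw [hpc, this]
    have k1 := hx.step _ hi.1
    have k2 := hy.step _ hi.2
    rw [cl_lo k1, cl_hi k1, cl_lo k2, cl_hi k2]
    · rw [hy'.lst]; exact (hy.le (by omega)).trans hd'
    · rw [hy'.fst]; exact hc.trans (hy.ge (by omega))
    · rw [hx'.lst]; exact (hx.le (by omega)).trans hb
    · rw [hx'.fst]; exact ha.trans (hx.ge (by omega))
  have s2 : ∀ F, ∀ k ∈ Finset.range n' ×ˢ Finset.range m',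
      ∑ i ∈ Finset.range n ×ˢ Finset.range m, pc F i k =
      D F (cl (x' k.1) (x' (k.1+1)) a) (cl (x' k.1) (x' (k.1+1)) b)
      (cl (y' k.2) (y' (k.2+1)) c) (cl (y' k.2) (y' (k.2+1)) d) := by
    intro F k hk
    rw [Finset.sum_congr rfl fun i hi => sym F i k hi hk]
    rw [tot F (fun i => cl (x' k.1) (x' (k.1+1)) (x i)) (fun i => cl (y' k.2) (y' (k.2+1)) (y i))]
    rw [hx.fst, hx.lst, hy.fst, hy.lst]
  have t1 : ∀ F, ∑ i ∈ Finset.range n ×ˢ Finset.range m,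
      D F (x i.1) (x (i.1+1)) (y i.2) (y (i.2+1)) = D F a b c d := by
    intro F; rw [tot, hx.fst, hx.lst, hy.fst, hy.lst]
  have t2 : ∀ F, ∑ i ∈ Finset.range n' ×ˢ Finset.range m',
      D F (x' i.1) (x' (i.1+1)) (y' i.2) (y' (i.2+1)) = D F a' b' c' d' := by
    intro F; rw [tot, hx'.fst, hx'.lst, hy'.fst, hy'.lst]
  rw [RSSum_eq, RSSum_eq, ← t1 W, ← t2 W]
  refine abs_key _ _ _ _ (pc f) (pc W) _ _ _ _ ε C (s1 f) (s1 W) ?_ (fun _ _ => hC _ _) ?_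
  · intro i hi k hk
    simp only [Finset.mem_product, Finset.mem_range] at hi hk
    have hm1 := cl_mono (x i.1) (x (i.1+1)) (hx'.step _ hk.1)
    have hm2 := cl_mono (y i.2) (y (i.2+1)) (hy'.step _ hk.2)
    have hdom : |pc f i k| ≤ pc W i k := hd _ _ _ _ hm1 hm2
    rcases cl_swap (hx.step _ hi.1) (hx'.step _ hk.1) with ⟨-, -, p, hp, hp'⟩ | ⟨e1, -⟩
    swap
    · simp [hpc, D, e1]
    rcases cl_swap (hy.step _ hi.2) (hy'.step _ hk.2) with ⟨-, -, q, hq, hq'⟩ | ⟨e1, -⟩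
    swap
    · simp [hpc, D, e1]
    obtain ⟨A1, A2⟩ := ht i.1 hi.1 i.2 hi.2
    obtain ⟨B1, B2⟩ := ht' k.1 hk.1 k.2 hk.2
    have m1 := hx.mesh _ hi.1
    have m2 := hy.mesh _ hi.2
    have m3 := hx'.mesh _ hk.1
    have m4 := hy'.mesh _ hk.2
    have r1 := hx.ge (i := i.1) (by omega)
    have r2 := hx.le (i := i.1+1) (by omega)
    have r3 := hy.ge (i := i.2) (by omega)
    have r4 := hy.le (i := i.2+1) (by omega)
    have r5 := hx'.ge (i := k.1) (by omega)
    have r6 := hx'.le (i := k.1+1) (by omega)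
    have r7 := hy'.ge (i := k.2) (by omega)
    have r8 := hy'.le (i := k.2+1) (by omega)
    simp only [mem_Icc] at hp hp' hq hq' A1 A2 B1 B2
    have hε := hu (ξ i.1 i.2) ⟨by linarith, by linarith⟩ (η i.1 i.2) ⟨by linarith, by linarith⟩
      (ξ' k.1 k.2) ⟨by linarith, by linarith⟩ (η' k.1 k.2) ⟨by linarith, by linarith⟩
      (by rw [abs_lt]; constructor <;> linarith) (by rw [abs_lt]; constructor <;> linarith)
    rw [abs_mul]
    exact mul_le_mul hε hdom (abs_nonneg _) ((abs_nonneg _).trans hε)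
  · intro k hk
    rw [s2 f k hk, s2 W k hk]
    simp only [Finset.mem_product, Finset.mem_range] at hk
    exact hd.sub (le_cl _ _ _) (cl_mono _ _ hab) (cl_le (hx'.step _ hk.1) _)
      (le_cl _ _ _) (cl_mono _ _ hcd) (cl_le (hy'.step _ hk.2) _)

/-- Integral over weak partitions. -/
def WRS (g f : ℝ → ℝ → ℝ) (a b c d A : ℝ) : Prop :=
  ∀ ε > 0, ∃ δ > 0, ∀ (n m : ℕ) (x y : ℕ → ℝ) (ξ η : ℕ → ℕ → ℝ),
    WP x n a b δ → WP y m c d δ → Tags x y ξ η n m → |RSSum g f x y ξ η n m - A| < ε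

theorem WP.weaken {x n a b δ δ'} (h : WP x n a b δ) (hd : δ ≤ δ') : WP x n a b δ' :=
  ⟨h.fst, h.lst, h.step, fun i hi => (h.mesh i hi).trans_le hd⟩

theorem exists_tagged {a b c d δ : ℝ} (hab : a ≤ b) (hcd : c ≤ d) (hδ : 0 < δ) :
    ∃ (n m : ℕ) (x y : ℕ → ℝ) (ξ η : ℕ → ℕ → ℝ), WP x n a b δ ∧ WP y m c d δ ∧
      Tags x y ξ η n m := by
  obtain ⟨n, x, hx⟩ := WP.exists hab hδ
  obtain ⟨m, y, hy⟩ := WP.exists hcd hδ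
  exact ⟨n, m, x, y, fun i _ => x i, fun _ j => y j, hx, hy, fun i hi j hj =>
    ⟨⟨le_rfl, hx.step i hi⟩, ⟨le_rfl, hy.step j hj⟩⟩⟩

theorem WRS.rs {g f : ℝ → ℝ → ℝ} {a b c d A : ℝ} (h : WRS g f a b c d A) (hab : a < b)
    (hcd : c < d) : RSIntegralOn g f a b c d A := by
  intro ε hε
  obtain ⟨δ, hδ, H⟩ := h ε hε
  refine ⟨δ, hδ, ?_⟩
  rintro n m x y ξ η ⟨h0, hn, k0, km, hx, hy⟩ ht hmesh
  have n0 : 0 < n := by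
    rcases Nat.eq_zero_or_pos n with e | e
    · subst e; linarith
    · exact e
  have m0 : 0 < m := by
    rcases Nat.eq_zero_or_pos m with e | e
    · subst e; linarith
    · exact e
  refine H n m x y ξ η ⟨h0, hn, fun i hi => (hx i hi).le, fun i hi => ?_⟩
    ⟨k0, km, fun i hi => (hy i hi).le, fun j hj => ?_⟩ ht
  · refine lt_of_le_of_lt (Real.le_sqrt_of_sq_le ?_) (hmesh i hi 0 m0)
    nlinarith [sq_nonneg (y (0+1) - y 0)]
  · refine lt_of_le_of_lt (Real.le_sqrt_of_sq_le ?_) (hmesh 0 n0 j hj)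
    nlinarith [sq_nonneg (x (0+1) - x 0)]

theorem WRS.exists {g f W : ℝ → ℝ → ℝ} (hd : Dom f W) {C : ℝ} (hC : ∀ s t, |g s t| ≤ C)
    (hg : Continuous fun p : ℝ × ℝ => g p.1 p.2) {a b c d : ℝ} (hab : a ≤ b) (hcd : c ≤ d) :
    ∃ A, WRS g f a b c d A := by
  have hpos : ∀ N : ℕ, (0:ℝ) < 1 / ((N:ℝ) + 1) := fun N => Nat.one_div_pos_of_nat
  choose n m x y ξ η hx hy ht using fun N : ℕ => exists_tagged hab hcd (hpos N)
  set u : ℕ → ℝ := fun N => RSSum g f (x N) (y N) (ξ N) (η N) (n N) (m N) with hu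
  have hD := hd.nonneg hab hcd
  -- comparison
  have cmp : ∀ ε > 0, ∃ δ > 0, ∀ (n m : ℕ) (x y : ℕ → ℝ) (ξ η : ℕ → ℕ → ℝ)
      (n' m' : ℕ) (x' y' : ℕ → ℝ) (ξ' η' : ℕ → ℕ → ℝ),
      WP x n a b δ → WP y m c d δ → Tags x y ξ η n m →
      WP x' n' a b δ → WP y' m' c d δ → Tags x' y' ξ' η' n' m' →
      |RSSum g f x y ξ η n m - RSSum g f x' y' ξ' η' n' m'| < ε := by
    intro ε hε
    obtain ⟨δ, hδ, hU⟩ := UC.exists hg a b c d (ε := ε / (D W a b c d + 1)) (by positivity)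
    refine ⟨δ, hδ, ?_⟩
    intro n m x y ξ η n' m' x' y' ξ' η' h1 h2 h3 h4 h5 h6
    have := key hd hC le_rfl hab le_rfl le_rfl hcd le_rfl hU le_rfl le_rfl h1 h2 h3 h4 h5 h6
    refine lt_of_le_of_lt this ?_
    rw [sub_self, mul_zero, add_zero, div_mul_eq_mul_div, div_lt_iff₀ (by positivity)]
    nlinarith
  have small : ∀ δ > 0, ∃ N : ℕ, ∀ k ≥ N, 1 / ((k:ℝ) + 1) ≤ δ := by
    intro δ hδ
    obtain ⟨N, hN⟩ := exists_nat_one_div_lt hδ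
    exact ⟨N, fun k hk => (Nat.one_div_le_one_div hk).trans hN.le⟩
  have hcau : CauchySeq u := by
    rw [Metric.cauchySeq_iff]
    intro ε hε
    obtain ⟨δ, hδ, h⟩ := cmp ε hε
    obtain ⟨N, hN⟩ := small δ hδ
    refine ⟨N, fun k hk l hl => ?_⟩
    rw [Real.dist_eq]
    exact h _ _ _ _ _ _ _ _ _ _ _ _ ((hx k).weaken (hN k hk)) ((hy k).weaken (hN k hk)) (ht k)
      ((hx l).weaken (hN l hl)) ((hy l).weaken (hN l hl)) (ht l)
  obtain ⟨A, hA⟩ := cauchySeq_tendsto_of_complete hcau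
  refine ⟨A, fun ε hε => ?_⟩
  obtain ⟨δ, hδ, h⟩ := cmp (ε/2) (by positivity)
  obtain ⟨N, hN⟩ := small δ hδ
  obtain ⟨N', hN'⟩ := (Metric.tendsto_atTop.mp hA) (ε/2) (by positivity)
  refine ⟨δ, hδ, fun n m x y ξ η h1 h2 h3 => ?_⟩
  have k1 := hN _ (le_max_left N N')
  have k2 := hN' _ (le_max_right N N')
  have k3 := h _ _ _ _ _ _ _ _ _ _ _ _ h1 h2 h3 ((hx _).weaken k1) ((hy _).weaken k1)
    (ht (max N N'))
  rw [Real.dist_eq] at k2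
  have k4 := abs_sub_le (RSSum g f x y ξ η n m) (u (max N N')) A
  have k5 : |RSSum g f x y ξ η n m - u (max N N')| < ε / 2 := k3
  linarith

theorem WRS.nested {g f W : ℝ → ℝ → ℝ} (hd : Dom f W) {C : ℝ} (hC : ∀ s t, |g s t| ≤ C)
    (hg : Continuous fun p : ℝ × ℝ => g p.1 p.2) {a b c d a' b' c' d' A A' : ℝ}
    (ha : a' ≤ a) (hab : a ≤ b) (hb : b ≤ b') (hc : c' ≤ c) (hcd : c ≤ d) (hd' : d ≤ d')
    (h : WRS g f a b c d A) (h' : WRS g f a' b' c' d' A') :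
    |A - A'| ≤ C * (D W a' b' c' d' - D W a b c d) := by
  have hD := hd.nonneg hab hcd
  refine le_of_forall_pos_le_add fun ε hε => ?_
  obtain ⟨δ, hδ, hU⟩ := UC.exists hg a' b' c' d' (ε := ε / 3 / (D W a b c d + 1)) (by positivity)
  obtain ⟨δ₁, hδ₁, k1⟩ := h (ε/3) (by positivity)
  obtain ⟨δ₂, hδ₂, k2⟩ := h' (ε/3) (by positivity)
  obtain ⟨n, m, x, y, ξ, η, hx, hy, ht⟩ := exists_tagged hab hcd (lt_min hδ hδ₁)
  obtain ⟨n', m', x', y', ξ', η', hx', hy', ht'⟩ := exists_tagged ((ha.trans hab).trans hb)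
    ((hc.trans hcd).trans hd') (lt_min hδ hδ₂)
  have e := key hd hC ha hab hb hc hcd hd' hU (min_le_left _ _) (min_le_left _ _) hx hy ht
    hx' hy' ht'
  have e1 := k1 _ _ _ _ _ _ (hx.weaken (min_le_right _ _)) (hy.weaken (min_le_right _ _)) ht
  have e2 := k2 _ _ _ _ _ _ (hx'.weaken (min_le_right _ _)) (hy'.weaken (min_le_right _ _)) ht'
  have e3 : ε / 3 / (D W a b c d + 1) * D W a b c d ≤ ε / 3 := by
    rw [div_mul_eq_mul_div, div_le_iff₀ (by positivity)]
    nlinarith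
  rw [abs_lt] at e1 e2
  rw [abs_le] at e ⊢
  constructor <;> linarith [e.1, e.2, e1.1, e1.2, e2.1, e2.2]

theorem improper {g f W : ℝ → ℝ → ℝ} (hd : Dom f W) {C K : ℝ} (hC : ∀ s t, |g s t| ≤ C)
    (hK : ∀ p q r s, D W p q r s ≤ K)
    (hg : Continuous fun p : ℝ × ℝ => g p.1 p.2) :
    ∃ I, ∀ ε > 0, ∃ M : ℝ, 1 ≤ M ∧ ∀ a b c d : ℝ, a ≤ -M → M ≤ b → c ≤ -M → M ≤ d →
      ∀ B, WRS g f a b c d B → |B - I| < ε := by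
  have hC0 : 0 ≤ C := (abs_nonneg _).trans (hC 0 0)
  set v : ℕ → ℝ := fun N => D W (-N) N (-N) N with hv
  have sub : ∀ {a b c d a' b' c' d' : ℝ}, a' ≤ a → a ≤ b → b ≤ b' → c' ≤ c → c ≤ d → d ≤ d' →
      D W a b c d ≤ D W a' b' c' d' := fun h1 h2 h3 h4 h5 h6 => by
    have := (abs_nonneg _).trans (hd.sub h1 h2 h3 h4 h5 h6); linarith
  have neg : ∀ N : ℕ, -(N:ℝ) ≤ N := fun N => by
    have : (0:ℝ) ≤ N := Nat.cast_nonneg N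
    linarith
  have vmono : Monotone v := by
    intro N N' h
    have : (N:ℝ) ≤ N' := by exact_mod_cast h
    exact sub (by linarith) (neg N) this (by linarith) (neg N) this
  have vb : BddAbove (Set.range v) := ⟨K, by rintro _ ⟨N, rfl⟩; exact hK _ _ _ _⟩
  set L := ⨆ N, v N with hL
  have vt : Tendsto v atTop (𝓝 L) := tendsto_atTop_ciSup vmono vb
  have leL : ∀ a b c d : ℝ, a ≤ b → c ≤ d → D W a b c d ≤ L := by
    intro a b c d hab hcd
    obtain ⟨N, hN⟩ := exists_nat_ge (max (max |a| |b|) (max |c| |d|))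
    simp only [max_le_iff] at hN
    obtain ⟨⟨h1, h2⟩, h3, h4⟩ := hN
    rw [abs_le] at h1 h2 h3 h4
    exact (sub h1.1 hab h2.2 h3.1 hcd h4.2).trans (le_ciSup vb N)
  choose A hA using fun N : ℕ => WRS.exists hd hC hg (neg N) (neg N)
  have small : ∀ ε > 0, ∃ N₀ : ℕ, ∀ N ≥ N₀, C * (L - v N) < ε := by
    intro ε hε
    have : Tendsto (fun N => C * (L - v N)) atTop (𝓝 (C * (L - L))) :=
      (tendsto_const_nhds.sub vt).const_mul C
    rw [sub_self, mul_zero] at this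
    exact eventually_atTop.mp (this.eventually_lt_const hε)
  have near : ∀ (N : ℕ) (a b c d B : ℝ), a ≤ -N → N ≤ b → c ≤ -N → N ≤ d →
      WRS g f a b c d B → |A N - B| ≤ C * (L - v N) := by
    intro N a b c d B h1 h2 h3 h4 hB
    refine (WRS.nested hd hC hg h1 (neg N) h2 h3 (neg N) h4 (hA N) hB).trans ?_
    refine mul_le_mul_of_nonneg_left ?_ hC0
    have := leL a b c d (h1.trans ((neg N).trans h2)) (h3.trans ((neg N).trans h4))
    exact sub_le_sub_right this _
  have hcau : CauchySeq A := by
    rw [Metric.cauchySeq_iff']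
    intro ε hε
    obtain ⟨N, hN⟩ := small ε hε
    refine ⟨N, fun k hk => ?_⟩
    have hk' : (N:ℝ) ≤ k := by exact_mod_cast hk
    rw [dist_comm, Real.dist_eq]
    exact (near N _ _ _ _ _ (by linarith) hk' (by linarith) hk' (hA k)).trans_lt (hN N le_rfl)
  obtain ⟨I, hI⟩ := cauchySeq_tendsto_of_complete hcau
  refine ⟨I, fun ε hε => ?_⟩
  obtain ⟨N₁, h1⟩ := small (ε/2) (by positivity)
  obtain ⟨N₂, h2⟩ := (Metric.tendsto_atTop.mp hI) (ε/2) (by positivity)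
  set N := max (max N₁ N₂) 1 with hN
  have k1 := h1 N ((le_max_left _ _).trans (le_max_left _ _))
  have k2 := h2 N ((le_max_right _ _).trans (le_max_left _ _))
  refine ⟨N, by exact_mod_cast le_max_right (max N₁ N₂) 1, fun a b c d ha hb hc hd' B hB => ?_⟩
  have k3 := near N a b c d B ha hb hc hd' hB
  rw [Real.dist_eq, abs_lt] at k2
  rw [abs_le] at k3
  rw [abs_lt]
  constructor <;> linarith [k2.1, k2.2, k3.1, k3.2]

theorem abs_RSSum_le {g f W : ℝ → ℝ → ℝ} (hd : Dom f W) {n m : ℕ} {x y : ℕ → ℝ}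
    {ξ η : ℕ → ℕ → ℝ} (hx : ∀ i < n, x i ≤ x (i+1)) (hy : ∀ j < m, y j ≤ y (j+1)) :
    |RSSum g f x y ξ η n m| ≤ RSSum (fun s t => |g s t|) W x y ξ η n m := by
  rw [RSSum_eq, RSSum_eq]
  refine (Finset.abs_sum_le_sum_abs _ _).trans (Finset.sum_le_sum fun i hi => ?_)
  simp only [Finset.mem_product, Finset.mem_range] at hi
  rw [abs_mul]
  exact mul_le_mul_of_nonneg_left (hd _ _ _ _ (hx _ hi.1) (hy _ hi.2)) (abs_nonneg _)

theorem WRS.abs_le {g f W : ℝ → ℝ → ℝ} (hd : Dom f W) {a b c d A B : ℝ} (hab : a ≤ b)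
    (hcd : c ≤ d) (hA : WRS g f a b c d A) (hB : WRS (fun s t => |g s t|) W a b c d B) :
    |A| ≤ B := by
  refine le_of_forall_pos_le_add fun ε hε => ?_
  obtain ⟨δ₁, hδ₁, k1⟩ := hA (ε/2) (by positivity)
  obtain ⟨δ₂, hδ₂, k2⟩ := hB (ε/2) (by positivity)
  obtain ⟨n, m, x, y, ξ, η, hx, hy, ht⟩ := exists_tagged hab hcd (lt_min hδ₁ hδ₂)
  have e1 := k1 _ _ _ _ _ _ (hx.weaken (min_le_left _ _)) (hy.weaken (min_le_left _ _)) ht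
  have e2 := k2 _ _ _ _ _ _ (hx.weaken (min_le_right _ _)) (hy.weaken (min_le_right _ _)) ht
  have e3 := abs_RSSum_le (g := g) (ξ := ξ) (η := η) hd hx.step hy.step
  rw [abs_lt] at e1 e2
  rw [_root_.abs_le] at e3 ⊢
  constructor <;> linarith [e1.1, e1.2, e2.1, e2.2, e3.1, e3.2]

theorem main {g f W : ℝ → ℝ → ℝ} (hd : Dom f W) {C K : ℝ} (hC : ∀ s t, |g s t| ≤ C)
    (hK : ∀ p q r s, D W p q r s ≤ K)
    (hg : Continuous fun p : ℝ × ℝ => g p.1 p.2) :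
    ∃ I J : ℝ, ImproperRS g f I ∧ ImproperRS (fun s t => |g s t|) W J ∧ |I| ≤ J := by
  have hC' : ∀ s t, |(fun s t => |g s t|) s t| ≤ C := fun s t => by simpa using hC s t
  have hg' : Continuous fun p : ℝ × ℝ => (fun s t => |g s t|) p.1 p.2 := hg.abs
  obtain ⟨I, hI⟩ := improper hd hC hK hg
  obtain ⟨J, hJ⟩ := improper hd.self hC' hK hg'
  have conv : ∀ (g f : ℝ → ℝ → ℝ) (I : ℝ), Dom f W → (∀ s t, |g s t| ≤ C) →
      (Continuous fun p : ℝ × ℝ => g p.1 p.2) →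
      (∀ ε > 0, ∃ M : ℝ, 1 ≤ M ∧ ∀ a b c d : ℝ, a ≤ -M → M ≤ b → c ≤ -M → M ≤ d →
      ∀ B, WRS g f a b c d B → |B - I| < ε) → ImproperRS g f I := by
    intro g f I hd hC hg h ε hε
    obtain ⟨M, hM, H⟩ := h ε hε
    refine ⟨M, fun a b c d h1 h2 h3 h4 => ?_⟩
    have hab : a < b := by linarith
    have hcd : c < d := by linarith
    obtain ⟨B, hB⟩ := WRS.exists hd hC hg hab.le hcd.le
    exact ⟨B, hB.rs hab hcd, H a b c d h1 h2 h3 h4 B hB⟩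
  refine ⟨I, J, conv _ _ _ hd hC hg hI, conv _ _ _ hd.self hC' hg' hJ, ?_⟩
  refine le_of_forall_pos_le_add fun ε hε => ?_
  obtain ⟨M₁, h1, H1⟩ := hI (ε/2) (by positivity)
  obtain ⟨M₂, h2, H2⟩ := hJ (ε/2) (by positivity)
  have l1 := le_max_left M₁ M₂
  have l2 := le_max_right M₁ M₂
  set M := max M₁ M₂
  have hM : -M ≤ M := by linarith
  obtain ⟨A, hA⟩ := WRS.exists hd hC hg hM hM
  obtain ⟨B, hB⟩ := WRS.exists hd.self hC' hg' hM hM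
  have e1 := H1 _ _ _ _ (by linarith) l1 (by linarith) l1 A hA
  have e2 := H2 _ _ _ _ (by linarith) l2 (by linarith) l2 B hB
  have e3 := WRS.abs_le hd hM hM hA hB
  rw [abs_lt] at e1 e2
  rw [abs_le] at e3 ⊢
  constructor <;> linarith [e1.1, e1.2, e2.1, e2.2, e3.1, e3.2]

end Stmt9Aux

/-- Lemma: for `g ∈ C_b(ℝ²)` and `f ∈ BV_V(ℝ²)`:
(i) `V(f;t₁,t₂) = Var(f, (−∞,t₁]×(−∞,t₂])` belongs to `BV_V(ℝ²)`, and
(ii) `|∬ g df| ≤ ∬ |g| dV(f;·,·)` (improper Riemann–Stieltjes integrals). -/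
theorem stmt9 (g f : ℝ → ℝ → ℝ)
    (hgc : Continuous fun p : ℝ × ℝ => g p.1 p.2)
    (hgb : ∃ C : ℝ, ∀ s t : ℝ, |g s t| ≤ C)
    (hf : BVV f) :
    BVV (fun t₁ t₂ => (vitaliVar f (Set.Iic t₁ ×ˢ Set.Iic t₂)).toReal) ∧
    ∃ I J : ℝ, ImproperRS g f I ∧
      ImproperRS (fun s t => |g s t|)
        (fun t₁ t₂ => (vitaliVar f (Set.Iic t₁ ×ˢ Set.Iic t₂)).toReal) J ∧
      |I| ≤ J := by
  obtain ⟨C, hC⟩ := hgb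
  exact ⟨Stmt9Aux.BVV_V hf, Stmt9Aux.main (W := Stmt9Aux.V f)
    (fun _ _ _ _ h1 h2 => Stmt9Aux.dom_V hf h1 h2) hC (Stmt9Aux.DV_le hf) hgc⟩
end
end

section
/- Let g ∈ C₀(ℝ²) (continuous vanishing at infinity) and f ∈ BV_V(ℝ²). Then there exists a σ-algebra 𝕄 on ℝ² containing the Borel sets and a unique positive finite measure μ on 𝕄 such that: (i) μ((a,b)×(c,d)) ≤ Var(f, [a,b]×[c,d]) for every open rectangle; and (ii) ∬_{ℝ²} g(t₁,t₂) dV(f; t₁,t₂) = ∬_{ℝ²} g dμ, where V(f; t₁,t₂) = Var(f, (−∞,t₁]×(−∞,t₂]) and the left side is an improper Riemann–Stieltjes integral. -/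
open Set Filter MeasureTheory Real
open scoped Topology ENNReal

noncomputable section

/-! ### Part 1: additivity of the Vitali variation -/

/-- The signed second-order increment. -/
def incr (W : ℝ → ℝ → ℝ) (u v s t : ℝ) : ℝ := W v t - W u t - W v s + W u s

lemma vitaliSum_eq (f : ℝ → ℝ → ℝ) (x y : ℕ → ℝ) (n m : ℕ) :
    vitaliSum f x y n m = ∑ i ∈ Finset.range n, ∑ j ∈ Finset.range m,
      |incr f (x i) (x (i+1)) (y j) (y (j+1))| := rfl

lemma vitaliSum_nonneg (f : ℝ → ℝ → ℝ) (x y : ℕ → ℝ) (n m : ℕ) :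
    0 ≤ vitaliSum f x y n m :=
  Finset.sum_nonneg fun _ _ => Finset.sum_nonneg fun _ _ => abs_nonneg _

lemma vitaliSum_flip (f : ℝ → ℝ → ℝ) (x y : ℕ → ℝ) (n m : ℕ) :
    vitaliSum (fun s t => f t s) y x m n = vitaliSum f x y n m := by
  rw [vitaliSum, vitaliSum, Finset.sum_comm]
  refine Finset.sum_congr rfl fun i _ => Finset.sum_congr rfl fun j _ => ?_
  congr 1; ring

lemma grid_mono {x : ℕ → ℝ} {n : ℕ} (hx : ∀ i < n, x i ≤ x (i+1)) {i j : ℕ} (hij : i ≤ j)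
    (hj : j ≤ n) : x i ≤ x j := by
  induction j, hij using Nat.le_induction with
  | base => exact le_rfl
  | succ k hk ih => exact (ih (by omega)).trans (hx k (by omega))

/-- Every nonempty finite set of reals is enumerated by a strict grid. -/
lemma exists_enum (s : Finset ℝ) (hs : s.Nonempty) :
    ∃ (p : ℕ) (z : ℕ → ℝ), (∀ k < p, z k < z (k+1)) ∧ (∀ k ≤ p, z k ∈ s) ∧
      ∀ u ∈ s, ∃ k ≤ p, z k = u := by
  induction s using Finset.induction_on_max with
  | empty => simp at hs
  | insert a s ha ih =>
    rcases s.eq_empty_or_nonempty with rfl | hne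
    · exact ⟨0, fun _ => a, by simp, by simp, by simp⟩
    · obtain ⟨p, z, h1, h2, h3⟩ := ih hne
      refine ⟨p+1, fun k => if k ≤ p then z k else a, ?_, ?_, ?_⟩
      · intro k hk
        by_cases hkp : k + 1 ≤ p
        · simp only [hkp, show k ≤ p by omega, if_true]; exact h1 k (by omega)
        · simp only [hkp, show k ≤ p by omega, if_true, if_false]
          exact ha _ (h2 k (by omega))
      · intro k hk
        by_cases hkp : k ≤ p
        · simp only [hkp, if_true]; exact Finset.mem_insert_of_mem (h2 k hkp)
        · simp [hkp]
      · intro u hu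
        rcases Finset.mem_insert.1 hu with rfl | hu
        · exact ⟨p+1, le_rfl, by simp⟩
        · obtain ⟨k, hk, rfl⟩ := h3 u hu
          exact ⟨k, by omega, by simp [hk]⟩

lemma refine_sum (ρ : ℝ → ℝ → ℝ) (h0 : ∀ u v, 0 ≤ ρ u v) (hself : ∀ u, ρ u u = 0)
    (htri : ∀ u v w, ρ u w ≤ ρ u v + ρ v w)
    {x z : ℕ → ℝ} {n p : ℕ} (hx : ∀ i < n, x i ≤ x (i+1)) (hz : ∀ k < p, z k < z (k+1))
    (hxz : ∀ i ≤ n, ∃ k ≤ p, z k = x i) :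
    ∑ i ∈ Finset.range n, ρ (x i) (x (i+1)) ≤ ∑ k ∈ Finset.range p, ρ (z k) (z (k+1)) := by
  -- chain triangle inequality
  have chain : ∀ a b, a ≤ b → ρ (z a) (z b) ≤ ∑ k ∈ Finset.Ico a b, ρ (z k) (z (k+1)) := by
    intro a b hab
    induction b, hab using Nat.le_induction with
    | base => simp [hself]
    | succ b hb ih =>
      rw [Finset.sum_Ico_succ_top hb]
      exact (htri _ (z b) _).trans (by linarith)
  have zlt : ∀ a b, a < b → b ≤ p → z a < z b := by
    intro a b hab
    induction b, hab using Nat.le_induction with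
    | base => intro h; exact hz a (by omega)
    | succ b hb ih => intro h; exact (ih (by omega)).trans (hz b (by omega))
  have key : ∀ l ≤ n, ∀ k ≤ p, z k = x l →
      ∑ i ∈ Finset.range l, ρ (x i) (x (i+1)) ≤ ∑ k ∈ Finset.range k, ρ (z k) (z (k+1)) := by
    intro l
    induction l with
    | zero => intro _ k _ _; simpa using Finset.sum_nonneg fun _ _ => h0 _ _
    | succ l ih =>
      intro hl k hk hkx
      obtain ⟨k', hk', hk'x⟩ := hxz l (by omega)
      have hkk : k' ≤ k := by
        by_contra hcon
        have h1 := zlt k k' (by omega) hk'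
        have h2 := hx l (by omega)
        rw [hkx, hk'x] at h1; linarith
      have := ih (by omega) k' hk' hk'x
      have h2 := chain k' k hkk
      rw [Finset.sum_range_succ, ← Finset.sum_range_add_sum_Ico _ hkk]
      rw [hkx, hk'x] at h2
      linarith
  obtain ⟨k, hk, hkx⟩ := hxz n le_rfl
  refine (key n le_rfl k hk hkx).trans ?_
  exact Finset.sum_le_sum_of_subset_of_nonneg (by simpa using hk) fun _ _ _ => h0 _ _

lemma vitaliSum_refine_x (f : ℝ → ℝ → ℝ) {x y z : ℕ → ℝ} {n m p : ℕ}
    (hx : ∀ i < n, x i ≤ x (i+1)) (hz : ∀ k < p, z k < z (k+1))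
    (hxz : ∀ i ≤ n, ∃ k ≤ p, z k = x i) : vitaliSum f x y n m ≤ vitaliSum f z y p m := by
  refine refine_sum (fun u v => ∑ j ∈ Finset.range m, |incr f u v (y j) (y (j+1))|)
    (fun _ _ => Finset.sum_nonneg fun _ _ => abs_nonneg _) ?_ ?_ hx hz hxz
  · intro u; simp [incr]
  · intro u v w
    rw [← Finset.sum_add_distrib]
    refine Finset.sum_le_sum fun j _ => ?_
    refine le_trans (le_of_eq ?_) (abs_add_le _ _)
    congr 1; simp only [incr]; ring

lemma vitaliSum_refine_y (f : ℝ → ℝ → ℝ) {x y w : ℕ → ℝ} {n m q : ℕ}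
    (hy : ∀ i < m, y i ≤ y (i+1)) (hw : ∀ k < q, w k < w (k+1))
    (hyw : ∀ i ≤ m, ∃ k ≤ q, w k = y i) : vitaliSum f x y n m ≤ vitaliSum f x w n q := by
  rw [← vitaliSum_flip f, ← vitaliSum_flip f]
  exact vitaliSum_refine_x _ hy hw hyw

lemma strict_le_vitaliVar (f : ℝ → ℝ → ℝ) {I J : Set ℝ} (hI : I.OrdConnected)
    (hJ : J.OrdConnected) {x y : ℕ → ℝ} {n m : ℕ}
    (hx : ∀ i < n, x i < x (i+1)) (hy : ∀ j < m, y j < y (j+1))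
    (hxI : ∀ i ≤ n, x i ∈ I) (hyJ : ∀ j ≤ m, y j ∈ J) :
    ENNReal.ofReal (vitaliSum f x y n m) ≤ vitaliVar f (I ×ˢ J) := by
  have hsub : Set.Icc (x 0) (x n) ×ˢ Set.Icc (y 0) (y m) ⊆ I ×ˢ J :=
    Set.prod_mono (hI.out (hxI 0 (by omega)) (hxI n le_rfl))
      (hJ.out (hyJ 0 (by omega)) (hyJ m le_rfl))
  unfold vitaliVar
  exact le_iSup_of_le n <| le_iSup_of_le m <| le_iSup_of_le x <| le_iSup_of_le y <|
    le_iSup_of_le hx <| le_iSup_of_le hy <| le_iSup_of_le hsub le_rfl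

lemma le_vitaliVar (f : ℝ → ℝ → ℝ) {I J : Set ℝ} (hI : I.OrdConnected)
    (hJ : J.OrdConnected) {x y : ℕ → ℝ} {n m : ℕ}
    (hx : ∀ i < n, x i ≤ x (i+1)) (hy : ∀ j < m, y j ≤ y (j+1))
    (hxI : ∀ i ≤ n, x i ∈ I) (hyJ : ∀ j ≤ m, y j ∈ J) :
    ENNReal.ofReal (vitaliSum f x y n m) ≤ vitaliVar f (I ×ˢ J) := by
  obtain ⟨p, z, hz, hzs, hsz⟩ := exists_enum ((Finset.range (n+1)).image x) (by simp)
  obtain ⟨q, w, hw, hws, hsw⟩ := exists_enum ((Finset.range (m+1)).image y) (by simp)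
  have h1 : vitaliSum f x y n m ≤ vitaliSum f z y p m :=
    vitaliSum_refine_x f hx hz fun i hi => hsz _ (Finset.mem_image_of_mem _ (by simp; omega))
  have h2 : vitaliSum f z y p m ≤ vitaliSum f z w p q :=
    vitaliSum_refine_y f hy hw fun i hi => hsw _ (Finset.mem_image_of_mem _ (by simp; omega))
  refine (ENNReal.ofReal_le_ofReal (h1.trans h2)).trans
    (strict_le_vitaliVar f hI hJ hz hw ?_ ?_)
  · intro k hk
    obtain ⟨i, hi, h⟩ := Finset.mem_image.1 (hzs k hk)
    rw [← h]; exact hxI i (by simp at hi; omega)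
  · intro k hk
    obtain ⟨i, hi, h⟩ := Finset.mem_image.1 (hws k hk)
    rw [← h]; exact hyJ i (by simp at hi; omega)

lemma grid_mem {x : ℕ → ℝ} {n : ℕ} (hx : ∀ i < n, x i < x (i+1)) {i : ℕ} (hi : i ≤ n) :
    x i ∈ Set.Icc (x 0) (x n) :=
  ⟨grid_mono (fun i hi => (hx i hi).le) (by omega) hi,
    grid_mono (fun i hi => (hx i hi).le) hi le_rfl⟩

lemma lt_vitaliVar (f : ℝ → ℝ → ℝ) {I J : Set ℝ} {c : ℝ≥0∞} (h : c < vitaliVar f (I ×ˢ J)) :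
    ∃ (n m : ℕ) (x y : ℕ → ℝ), (∀ i < n, x i < x (i+1)) ∧ (∀ j < m, y j < y (j+1)) ∧
      (∀ i ≤ n, x i ∈ I) ∧ (∀ j ≤ m, y j ∈ J) ∧ c < ENNReal.ofReal (vitaliSum f x y n m) := by
  unfold vitaliVar at h
  simp only [lt_iSup_iff] at h
  obtain ⟨n, m, x, y, hx, hy, hsub, h⟩ := h
  refine ⟨n, m, x, y, hx, hy, fun i hi => ?_, fun j hj => ?_, h⟩
  · exact (hsub (Set.mk_mem_prod (grid_mem hx hi) (grid_mem hy (Nat.zero_le _)))).1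
  · exact (hsub (Set.mk_mem_prod (grid_mem hx (Nat.zero_le _)) (grid_mem hy hj))).2

lemma vitaliVar_le (f : ℝ → ℝ → ℝ) {I J : Set ℝ} {C : ℝ≥0∞}
    (h : ∀ (n m : ℕ) (x y : ℕ → ℝ), (∀ i < n, x i < x (i+1)) → (∀ j < m, y j < y (j+1)) →
      (∀ i ≤ n, x i ∈ I) → (∀ j ≤ m, y j ∈ J) → ENNReal.ofReal (vitaliSum f x y n m) ≤ C) :
    vitaliVar f (I ×ˢ J) ≤ C := by
  by_contra hcon
  obtain ⟨n, m, x, y, hx, hy, hxI, hyJ, hlt⟩ := lt_vitaliVar f (not_le.1 hcon)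
  exact absurd (h n m x y hx hy hxI hyJ) (not_le.2 hlt)

lemma vitaliVar_mono (f : ℝ → ℝ → ℝ) {Q Q' : Set (ℝ × ℝ)} (h : Q ⊆ Q') :
    vitaliVar f Q ≤ vitaliVar f Q' := by
  unfold vitaliVar
  refine iSup_mono fun n => iSup_mono fun m => iSup_mono fun x => iSup_mono fun y =>
    iSup_mono fun hx => iSup_mono fun hy => ?_
  exact iSup_le fun hs => le_iSup_of_le (hs.trans h) le_rfl

lemma vitaliVar_flip (f : ℝ → ℝ → ℝ) {I J : Set ℝ} (hI : I.OrdConnected)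
    (hJ : J.OrdConnected) :
    vitaliVar (fun s t => f t s) (J ×ˢ I) = vitaliVar f (I ×ˢ J) := by
  apply le_antisymm
  · refine vitaliVar_le _ fun n m x y hx hy hxI hyJ => ?_
    rw [vitaliSum_flip f y x m n]
    exact strict_le_vitaliVar f hI hJ hy hx hyJ hxI
  · refine vitaliVar_le _ fun n m x y hx hy hxI hyJ => ?_
    rw [← vitaliSum_flip f x y n m]
    exact strict_le_vitaliVar _ hJ hI hy hx hyJ hxI

lemma enn_add_le {a b c : ℝ≥0∞} (h : ∀ a' < a, ∀ b' < b, a' + b' ≤ c) (ha : 0 < a)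
    (hb : 0 < b) : a + b ≤ c := by
  have hab : ∀ a' < a, a' + b ≤ c := by
    intro a' ha'
    rw [add_comm]
    by_cases hle : a' ≤ c
    · have : b ≤ c - a' := le_of_forall_lt fun b' hb' => by
        obtain ⟨b'', h1, h2⟩ := exists_between hb'
        exact lt_of_lt_of_le h1 (ENNReal.le_sub_of_add_le_left ha'.ne_top (h a' ha' b'' h2))
      calc b + a' ≤ (c - a') + a' := by gcongr
        _ = c := tsub_add_cancel_of_le hle
    · exact absurd ((le_self_add).trans (h a' ha' 0 hb)) hle
  by_cases hbt : b = ⊤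
  · have := hab 0 ha
    simp [hbt] at this; simp [this]
  have hle : b ≤ c := le_add_self.trans (hab 0 ha)
  have : a ≤ c - b := le_of_forall_lt fun a' ha' => by
        obtain ⟨a'', h1, h2⟩ := exists_between ha'
        exact lt_of_lt_of_le h1 (ENNReal.le_sub_of_add_le_right hbt (hab a'' h2))
  calc a + b ≤ (c - b) + b := by gcongr
    _ = c := tsub_add_cancel_of_le hle

lemma vitaliVar_add_x (f : ℝ → ℝ → ℝ) {I₁ I₂ J : Set ℝ} {a : ℝ} (h1 : I₁.OrdConnected)
    (h2 : I₂.OrdConnected) (h : (I₁ ∪ I₂).OrdConnected) (hJ : J.OrdConnected)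
    (g1 : IsGreatest I₁ a) (g2 : IsLeast I₂ a) :
    vitaliVar f ((I₁ ∪ I₂) ×ˢ J) = vitaliVar f (I₁ ×ˢ J) + vitaliVar f (I₂ ×ˢ J) := by
  apply le_antisymm
  · refine vitaliVar_le f fun n m x y hx hy hxI hyJ => ?_
    have hle : vitaliSum f x y n m ≤ vitaliSum f (fun i => min (x i) a) y n m +
        vitaliSum f (fun i => max (x i) a) y n m := by
      simp only [vitaliSum_eq]
      rw [← Finset.sum_add_distrib]
      refine Finset.sum_le_sum fun i hi => ?_
      rw [← Finset.sum_add_distrib]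
      refine Finset.sum_le_sum fun j hj => ?_
      refine le_trans (le_of_eq ?_) (abs_add_le _ _)
      congr 1
      have := hx i (by simpa using hi)
      rcases le_total (x i) a with h3 | h3 <;> rcases le_total (x (i+1)) a with h4 | h4 <;>
        simp [h3, h4, incr]
      · ring
      · ring
    refine (ENNReal.ofReal_le_ofReal hle).trans ?_
    rw [ENNReal.ofReal_add (vitaliSum_nonneg _ _ _ _ _) (vitaliSum_nonneg _ _ _ _ _)]
    refine add_le_add (le_vitaliVar f h1 hJ ?_ (fun j hj => (hy j hj).le) ?_ hyJ)
      (le_vitaliVar f h2 hJ ?_ (fun j hj => (hy j hj).le) ?_ hyJ)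
    · intro i hi; exact min_le_min_right _ (hx i hi).le
    · intro i hi
      rcases le_total (x i) a with h3 | h3
      · simp only [h3, min_eq_left]
        rcases hxI i hi with h4 | h4
        · exact h4
        · rw [le_antisymm h3 (g2.2 h4)]; exact g1.1
      · simp only [h3, min_eq_right]; exact g1.1
    · intro i hi; exact max_le_max_right _ (hx i hi).le
    · intro i hi
      rcases le_total (x i) a with h3 | h3
      · simp only [h3, max_eq_right]; exact g2.1
      · simp only [h3, max_eq_left]
        rcases hxI i hi with h4 | h4
        · rw [← le_antisymm h3 (g1.2 h4)]; exact g2.1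
        · exact h4
  · rcases eq_or_ne (vitaliVar f (I₁ ×ˢ J)) 0 with h0 | h0
    · rw [h0, zero_add]; exact vitaliVar_mono f (Set.prod_mono subset_union_right le_rfl)
    rcases eq_or_ne (vitaliVar f (I₂ ×ˢ J)) 0 with h0' | h0'
    · rw [h0', add_zero]; exact vitaliVar_mono f (Set.prod_mono subset_union_left le_rfl)
    refine enn_add_le ?_ (pos_iff_ne_zero.2 h0) (pos_iff_ne_zero.2 h0')
    intro a' ha' b' hb'
    obtain ⟨n, m, x, y, hx, hy, hxI, hyJ, hc⟩ := lt_vitaliVar f ha'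
    obtain ⟨n', m', x', y', hx', hy', hxI', hyJ', hc'⟩ := lt_vitaliVar f hb'
    obtain ⟨q, w, hw, hws, hsw⟩ := exists_enum
      ((Finset.range (m+1)).image y ∪ (Finset.range (m'+1)).image y') (by simp)
    have k1 : vitaliSum f x y n m ≤ vitaliSum f x w n q :=
      vitaliSum_refine_y f (fun j hj => (hy j hj).le) hw fun i hi => hsw _
        (Finset.mem_union_left _ (Finset.mem_image_of_mem _ (by simp; omega)))
    have k2 : vitaliSum f x' y' n' m' ≤ vitaliSum f x' w n' q :=
      vitaliSum_refine_y f (fun j hj => (hy' j hj).le) hw fun i hi => hsw _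
        (Finset.mem_union_right _ (Finset.mem_image_of_mem _ (by simp; omega)))
    set u : ℕ → ℝ := fun i => if i ≤ n then x i else x' (i - (n+1)) with hu
    have k3 : vitaliSum f x w n q + vitaliSum f x' w n' q ≤ vitaliSum f u w (n + 1 + n') q := by
      conv_rhs => rw [vitaliSum_eq, Finset.sum_range_add, Finset.sum_range_succ]
      have e1 : vitaliSum f x w n q = ∑ i ∈ Finset.range n, ∑ j ∈ Finset.range q,
          |incr f (u i) (u (i+1)) (w j) (w (j+1))| := by
        rw [vitaliSum_eq]
        refine Finset.sum_congr rfl fun i hi => ?_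
        have : i < n := by simpa using hi
        simp [hu, this.le, show i + 1 ≤ n from this]
      have e2 : vitaliSum f x' w n' q = ∑ i ∈ Finset.range n', ∑ j ∈ Finset.range q,
          |incr f (u (n+1+i)) (u (n+1+i+1)) (w j) (w (j+1))| := by
        rw [vitaliSum_eq]
        refine Finset.sum_congr rfl fun i hi => ?_
        have a1 : u (n+1+i) = x' i := by
          simp [hu, show ¬ (n + 1 + i ≤ n) by omega]
        have a2 : u (n+1+i+1) = x' (i+1) := by
          simp only [hu, show ¬ (n + 1 + i + 1 ≤ n) by omega, if_false]
          congr 1; omega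
        rw [a1, a2]
      rw [e1, e2]
      have : 0 ≤ ∑ j ∈ Finset.range q, |incr f (u n) (u (n+1)) (w j) (w (j+1))| :=
        Finset.sum_nonneg fun _ _ => abs_nonneg _
      linarith
    have k4 : ENNReal.ofReal (vitaliSum f u w (n + 1 + n') q) ≤ vitaliVar f ((I₁ ∪ I₂) ×ˢ J) := by
      refine le_vitaliVar f h hJ ?_ (fun j hj => (hw j hj).le) ?_ ?_
      · intro i hi
        simp only [hu]
        by_cases c1 : i + 1 ≤ n
        · simp only [c1, show i ≤ n by omega, if_true]; exact (hx i (by omega)).le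
        · by_cases c2 : i ≤ n
          · simp only [c1, c2, if_true, if_false]
            exact (g1.2 (hxI i c2)).trans (g2.2 (hxI' _ (by omega)))
          · simp only [c1, c2, if_false]
            have := hx' (i - (n+1)) (by omega)
            rw [show i + 1 - (n+1) = i - (n+1) + 1 by omega]; exact this.le
      · intro i hi
        simp only [hu]
        by_cases c2 : i ≤ n
        · simp only [c2, if_true]; exact Or.inl (hxI i c2)
        · simp only [c2, if_false]; exact Or.inr (hxI' _ (by omega))
      · intro j hj
        rcases Finset.mem_union.1 (hws j hj) with hm | hm
        · obtain ⟨i, hi, h⟩ := Finset.mem_image.1 hm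
          rw [← h]; exact hyJ i (by simp at hi; omega)
        · obtain ⟨i, hi, h⟩ := Finset.mem_image.1 hm
          rw [← h]; exact hyJ' i (by simp at hi; omega)
    calc a' + b' ≤ ENNReal.ofReal (vitaliSum f x y n m) +
          ENNReal.ofReal (vitaliSum f x' y' n' m') := add_le_add hc.le hc'.le
      _ = ENNReal.ofReal (vitaliSum f x y n m + vitaliSum f x' y' n' m') :=
        (ENNReal.ofReal_add (vitaliSum_nonneg _ _ _ _ _) (vitaliSum_nonneg _ _ _ _ _)).symm
      _ ≤ ENNReal.ofReal (vitaliSum f u w (n + 1 + n') q) :=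
        ENNReal.ofReal_le_ofReal (by linarith)
      _ ≤ _ := k4

lemma vitaliVar_add_y (f : ℝ → ℝ → ℝ) {I₁ I₂ J : Set ℝ} {a : ℝ} (h1 : I₁.OrdConnected)
    (h2 : I₂.OrdConnected) (h : (I₁ ∪ I₂).OrdConnected) (hJ : J.OrdConnected)
    (g1 : IsGreatest I₁ a) (g2 : IsLeast I₂ a) :
    vitaliVar f (J ×ˢ (I₁ ∪ I₂)) = vitaliVar f (J ×ˢ I₁) + vitaliVar f (J ×ˢ I₂) := by
  rw [← vitaliVar_flip f hJ h1, ← vitaliVar_flip f hJ h2, ← vitaliVar_flip f hJ h]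
  exact vitaliVar_add_x _ h1 h2 h hJ g1 g2

lemma vitaliVar_ne_top {f : ℝ → ℝ → ℝ} (hf : BVV f) (Q : Set (ℝ × ℝ)) : vitaliVar f Q ≠ ⊤ :=
  ((vitaliVar_mono f (Set.subset_univ Q)).trans_lt hf).ne

/-- The variation function. -/
def varFun (f : ℝ → ℝ → ℝ) (t₁ t₂ : ℝ) : ℝ := (vitaliVar f (Set.Iic t₁ ×ˢ Set.Iic t₂)).toReal

lemma incr_varFun {f : ℝ → ℝ → ℝ} (hf : BVV f) {a b c d : ℝ} (hab : a ≤ b) (hcd : c ≤ d) :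
    incr (varFun f) a b c d = (vitaliVar f (Set.Icc a b ×ˢ Set.Icc c d)).toReal := by
  have ub : Set.Iic b = Set.Iic a ∪ Set.Icc a b := (Set.Iic_union_Icc_eq_Iic hab).symm
  have ud : Set.Iic d = Set.Iic c ∪ Set.Icc c d := (Set.Iic_union_Icc_eq_Iic hcd).symm
  have ga : IsGreatest (Set.Iic a) a := isGreatest_Iic
  have gc : IsGreatest (Set.Iic c) c := isGreatest_Iic
  have la : IsLeast (Set.Icc a b) a := isLeast_Icc hab
  have lc : IsLeast (Set.Icc c d) c := isLeast_Icc hcd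
  have X : ∀ J : Set ℝ, J.OrdConnected → vitaliVar f (Set.Iic b ×ˢ J) =
      vitaliVar f (Set.Iic a ×ˢ J) + vitaliVar f (Set.Icc a b ×ˢ J) := by
    intro J hJ
    rw [ub]
    exact vitaliVar_add_x f ordConnected_Iic ordConnected_Icc (ub ▸ ordConnected_Iic) hJ ga la
  have Y : vitaliVar f (Set.Icc a b ×ˢ Set.Iic d) =
      vitaliVar f (Set.Icc a b ×ˢ Set.Iic c) + vitaliVar f (Set.Icc a b ×ˢ Set.Icc c d) := by
    rw [ud]
    exact vitaliVar_add_y f ordConnected_Iic ordConnected_Icc (ud ▸ ordConnected_Iic)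
      ordConnected_Icc gc lc
  simp only [incr, varFun]
  rw [X (Set.Iic d) ordConnected_Iic, X (Set.Iic c) ordConnected_Iic, Y]
  have N := vitaliVar_ne_top hf
  rw [ENNReal.toReal_add (N _) (ENNReal.add_ne_top.2 ⟨N _, N _⟩),
    ENNReal.toReal_add (N _) (N _), ENNReal.toReal_add (N _) (N _)]
  ring

lemma incr_varFun_nonneg {f : ℝ → ℝ → ℝ} (hf : BVV f) {a b c d : ℝ} (hab : a ≤ b) (hcd : c ≤ d) :
    0 ≤ incr (varFun f) a b c d := by
  rw [incr_varFun hf hab hcd]; exact ENNReal.toReal_nonneg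

lemma incr_varFun_le {f : ℝ → ℝ → ℝ} (hf : BVV f) {a b c d : ℝ} (hab : a ≤ b) (hcd : c ≤ d) :
    incr (varFun f) a b c d ≤ (vitaliVar f Set.univ).toReal := by
  rw [incr_varFun hf hab hcd]
  exact ENNReal.toReal_mono (vitaliVar_ne_top hf _) (vitaliVar_mono f (Set.subset_univ _))

lemma incr_varFun_gt {f : ℝ → ℝ → ℝ} (hf : BVV f) {ε : ℝ} (hε : 0 < ε) :
    ∃ M > 0, (vitaliVar f Set.univ).toReal - ε < incr (varFun f) (-M) M (-M) M := by
  rcases eq_or_ne (vitaliVar f Set.univ) 0 with h0 | h0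
  · refine ⟨1, one_pos, ?_⟩
    have := incr_varFun_nonneg hf (a := -1) (b := 1) (c := -1) (d := 1) (by norm_num) (by norm_num)
    rw [h0]; simp only [ENNReal.toReal_zero]; linarith
  set T := (vitaliVar f Set.univ).toReal with hT
  have hlt : ENNReal.ofReal (T - ε) < vitaliVar f (Set.univ ×ˢ Set.univ) := by
    rw [Set.univ_prod_univ, ← ENNReal.ofReal_toReal (vitaliVar_ne_top hf Set.univ), ← hT]
    refine (ENNReal.ofReal_lt_ofReal_iff ?_).2 (by linarith)
    exact ENNReal.toReal_pos h0 (vitaliVar_ne_top hf _)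
  obtain ⟨n, m, x, y, hx, hy, -, -, hc⟩ := lt_vitaliVar f hlt
  refine ⟨|x 0| + |x n| + |y 0| + |y m| + 1, by positivity, ?_⟩
  set M := |x 0| + |x n| + |y 0| + |y m| + 1 with hM
  have p1 := abs_nonneg (x 0)
  have p2 := abs_nonneg (x n)
  have p3 := abs_nonneg (y 0)
  have p4 := abs_nonneg (y m)
  have hMM : -M ≤ M := by linarith
  rw [incr_varFun hf hMM hMM]
  have : ENNReal.ofReal (vitaliSum f x y n m) ≤ vitaliVar f (Set.Icc (-M) M ×ˢ Set.Icc (-M) M) := by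
    refine strict_le_vitaliVar f ordConnected_Icc ordConnected_Icc hx hy ?_ ?_
    · intro i hi
      have := grid_mem hx hi
      exact ⟨by linarith [this.1, neg_abs_le (x 0)], by linarith [this.2, le_abs_self (x n)]⟩
    · intro i hi
      have := grid_mem hy hi
      exact ⟨by linarith [this.1, neg_abs_le (y 0)], by linarith [this.2, le_abs_self (y m)]⟩
  have h3 := hc.trans_le this
  by_contra hcon
  have h4 := ENNReal.ofReal_le_ofReal (not_lt.1 hcon)
  rw [ENNReal.ofReal_toReal (vitaliVar_ne_top hf _)] at h4
  exact absurd h3 (not_lt.2 h4)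

/-! ### Part 2: comparison of Riemann–Stieltjes sums -/

lemma abstract_compare {α β : Type*} (I : Finset α) (K : Finset β) (N : α → β → ℝ)
    (gI vI : α → ℝ) (gK vK r : β → ℝ) {ε C : ℝ}
    (hN : ∀ i ∈ I, ∀ k ∈ K, |gI i - gK k| * N i k ≤ ε * N i k)
    (hN0 : ∀ i ∈ I, ∀ k ∈ K, 0 ≤ N i k)
    (hr : ∀ k ∈ K, 0 ≤ r k) (hC : ∀ k ∈ K, |gK k| ≤ C)
    (hI : ∀ i ∈ I, vI i = ∑ k ∈ K, N i k) (hK : ∀ k ∈ K, vK k = ∑ i ∈ I, N i k + r k) :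
    |∑ i ∈ I, gI i * vI i - ∑ k ∈ K, gK k * vK k| ≤ ε * ∑ i ∈ I, vI i + C * ∑ k ∈ K, r k := by
  have e1 : ∑ i ∈ I, gI i * vI i = ∑ i ∈ I, ∑ k ∈ K, gI i * N i k :=
    Finset.sum_congr rfl fun i hi => by rw [hI i hi, Finset.mul_sum]
  have e2 : ∑ k ∈ K, gK k * vK k = ∑ i ∈ I, ∑ k ∈ K, gK k * N i k + ∑ k ∈ K, gK k * r k := by
    rw [Finset.sum_comm, ← Finset.sum_add_distrib]
    exact Finset.sum_congr rfl fun k hk => by rw [hK k hk, mul_add, Finset.mul_sum]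
  have e3 : ∑ i ∈ I, gI i * vI i - ∑ k ∈ K, gK k * vK k =
      ∑ i ∈ I, ∑ k ∈ K, (gI i - gK k) * N i k - ∑ k ∈ K, gK k * r k := by
    rw [e1, e2]; simp only [sub_mul, Finset.sum_sub_distrib]; ring
  rw [e3]
  refine (abs_sub _ _).trans (add_le_add ?_ ?_)
  · rw [Finset.mul_sum]
    refine (Finset.abs_sum_le_sum_abs _ _).trans (Finset.sum_le_sum fun i hi => ?_)
    rw [hI i hi, Finset.mul_sum]
    refine (Finset.abs_sum_le_sum_abs _ _).trans (Finset.sum_le_sum fun k hk => ?_)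
    rw [abs_mul, abs_of_nonneg (hN0 i hi k hk)]
    exact hN i hi k hk
  · rw [Finset.mul_sum]
    refine (Finset.abs_sum_le_sum_abs _ _).trans (Finset.sum_le_sum fun k hk => ?_)
    rw [abs_mul, abs_of_nonneg (hr k hk)]
    exact mul_le_mul_of_nonneg_right (hC k hk) (hr k hk)

/-- Clamp `t` to `[a,b]`. -/
def clmp (a b t : ℝ) : ℝ := max a (min t b)

lemma clmp_mono {a b s t : ℝ} (h : s ≤ t) : clmp a b s ≤ clmp a b t :=
  max_le_max_left _ (min_le_min_right _ h)

lemma clmp_of_le {a b t : ℝ} (h : t ≤ a) : clmp a b t = a :=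
  max_eq_left ((min_le_left _ _).trans h)

lemma clmp_of_ge {a b t : ℝ} (hab : a ≤ b) (h : b ≤ t) : clmp a b t = b := by
  rw [clmp, min_eq_right h, max_eq_right hab]

lemma clmp_of_mem {a b t : ℝ} (h1 : a ≤ t) (h2 : t ≤ b) : clmp a b t = t := by
  rw [clmp, min_eq_left h2, max_eq_right h1]

lemma le_clmp (a b t : ℝ) : a ≤ clmp a b t := le_max_left _ _

lemma clmp_le {a b : ℝ} (hab : a ≤ b) (t : ℝ) : clmp a b t ≤ b := max_le hab (min_le_right _ _)

/-- The two ways of intersecting two intervals agree, up to degenerate ones. -/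
lemma clmp_swap {a b c d : ℝ} (hab : a ≤ b) (hcd : c ≤ d) :
    (clmp a b c = clmp c d a ∧ clmp a b d = clmp c d b) ∨
    (clmp a b c = clmp a b d ∧ clmp c d a = clmp c d b) := by
  rcases le_total b c with h | h
  · right
    rw [clmp_of_ge hab h, clmp_of_ge hab (h.trans hcd), clmp_of_le (hab.trans h), clmp_of_le h]
    exact ⟨rfl, rfl⟩
  rcases le_total d a with h' | h'
  · right
    rw [clmp_of_le h', clmp_of_le (hcd.trans h'), clmp_of_ge hcd h', clmp_of_ge hcd (h'.trans hab)]
    exact ⟨rfl, rfl⟩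
  · left
    simp only [clmp, min_eq_left h, min_eq_left h']
    refine ⟨max_comm _ _, ?_⟩
    rw [max_eq_right (le_min h' hab), max_eq_right (le_min h hcd), min_comm]

lemma incr_swap_x (W : ℝ → ℝ → ℝ) {a b c d : ℝ} (hab : a ≤ b) (hcd : c ≤ d) (s t : ℝ) :
    incr W (clmp a b c) (clmp a b d) s t = incr W (clmp c d a) (clmp c d b) s t := by
  rcases clmp_swap hab hcd with ⟨h1, h2⟩ | ⟨h1, h2⟩
  · rw [h1, h2]
  · rw [h1, h2]; simp [incr]

lemma incr_swap_y (W : ℝ → ℝ → ℝ) {a b c d : ℝ} (hab : a ≤ b) (hcd : c ≤ d) (s t : ℝ) :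
    incr W s t (clmp a b c) (clmp a b d) = incr W s t (clmp c d a) (clmp c d b) := by
  rcases clmp_swap hab hcd with ⟨h1, h2⟩ | ⟨h1, h2⟩
  · rw [h1, h2]
  · rw [h1, h2]; simp [incr]

lemma incr_tel (W : ℝ → ℝ → ℝ) (p q : ℕ → ℝ) (n m : ℕ) :
    ∑ k ∈ Finset.range n ×ˢ Finset.range m,
      incr W (p k.1) (p (k.1+1)) (q k.2) (q (k.2+1)) = incr W (p 0) (p n) (q 0) (q m) := by
  rw [Finset.sum_product]
  have inner : ∀ u v, ∑ l ∈ Finset.range m, incr W u v (q l) (q (l+1)) =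
      incr W u v (q 0) (q m) := by
    intro u v
    induction m with
    | zero => simp [incr]
    | succ m ih => rw [Finset.sum_range_succ, ih]; simp only [incr]; ring
  simp only [inner]
  induction n with
  | zero => simp [incr]
  | succ n ih => rw [Finset.sum_range_succ, ih]; simp only [incr]; ring

/-- `W` has nonnegative rectangular increments. -/
def RectMono (W : ℝ → ℝ → ℝ) : Prop :=
  ∀ a b c d : ℝ, a ≤ b → c ≤ d → 0 ≤ incr W a b c d

lemma RectMono.incr_mono {W : ℝ → ℝ → ℝ} (hW : RectMono W) {a b c d a' b' c' d' : ℝ}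
    (h1 : a' ≤ a) (h2 : a ≤ b) (h3 : b ≤ b') (h4 : c' ≤ c) (h5 : c ≤ d) (h6 : d ≤ d') :
    incr W a b c d ≤ incr W a' b' c' d' := by
  have q1 := hW a' a c d h1 h5
  have q2 := hW b b' c d h3 h5
  have q3 := hW a' b' c' c (h1.trans (h2.trans h3)) h4
  have q4 := hW a' b' d d' (h1.trans (h2.trans h3)) h6
  simp only [incr] at *
  linarith

/-- A tagged partition (data only). -/
structure TP where
  n : ℕ
  m : ℕ
  x : ℕ → ℝ
  y : ℕ → ℝ
  ξ : ℕ → ℕ → ℝ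
  η : ℕ → ℕ → ℝ

/-- The tagged partition is a partition of the given rectangle, with mesh `< δ`. -/
structure TP.Good (P : TP) (δ a b c d : ℝ) : Prop where
  part : IsPartition P.x P.y P.n P.m a b c d
  tags : Tags P.x P.y P.ξ P.η P.n P.m
  mesh : ∀ i < P.n, ∀ j < P.m, √((P.x (i+1) - P.x i)^2 + (P.y (j+1) - P.y j)^2) < δ

/-- Its Riemann–Stieltjes sum. -/
def TP.S (P : TP) (W g : ℝ → ℝ → ℝ) : ℝ := RSSum g W P.x P.y P.ξ P.η P.n P.m

lemma TP.S_eq (P : TP) (W g : ℝ → ℝ → ℝ) :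
    P.S W g = ∑ k ∈ Finset.range P.n ×ˢ Finset.range P.m, g (P.ξ k.1 k.2) (P.η k.1 k.2) *
      incr W (P.x k.1) (P.x (k.1+1)) (P.y k.2) (P.y (k.2+1)) := by
  rw [Finset.sum_product]; rfl

lemma TP.Good.mesh_x {P : TP} {δ a b c d : ℝ} (h : P.Good δ a b c d) {i j : ℕ} (hi : i < P.n)
    (hj : j < P.m) : P.x (i+1) - P.x i < δ := by
  refine lt_of_le_of_lt ?_ (h.mesh i hi j hj)
  exact Real.le_sqrt_of_sq_le (by nlinarith [sq_nonneg (P.y (j+1) - P.y j)])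

lemma TP.Good.mesh_y {P : TP} {δ a b c d : ℝ} (h : P.Good δ a b c d) {i j : ℕ} (hi : i < P.n)
    (hj : j < P.m) : P.y (j+1) - P.y j < δ := by
  refine lt_of_le_of_lt ?_ (h.mesh i hi j hj)
  exact Real.le_sqrt_of_sq_le (by nlinarith [sq_nonneg (P.x (i+1) - P.x i)])

lemma TP.Good.x_lt {P : TP} {δ a b c d : ℝ} (h : P.Good δ a b c d) {i : ℕ} (hi : i < P.n) :
    P.x i < P.x (i+1) := h.part.2.2.2.2.1 i hi

lemma TP.Good.y_lt {P : TP} {δ a b c d : ℝ} (h : P.Good δ a b c d) {i : ℕ} (hi : i < P.m) :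
    P.y i < P.y (i+1) := h.part.2.2.2.2.2 i hi

lemma TP.Good.x_mem {P : TP} {δ a b c d : ℝ} (h : P.Good δ a b c d) {i : ℕ} (hi : i ≤ P.n) :
    P.x i ∈ Set.Icc a b := by
  have := grid_mem h.part.2.2.2.2.1 hi
  rwa [h.part.1, h.part.2.1] at this

lemma TP.Good.y_mem {P : TP} {δ a b c d : ℝ} (h : P.Good δ a b c d) {i : ℕ} (hi : i ≤ P.m) :
    P.y i ∈ Set.Icc c d := by
  have := grid_mem h.part.2.2.2.2.2 hi
  rwa [h.part.2.2.1, h.part.2.2.2.1] at this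

lemma TP.Good.le_x {P : TP} {δ a b c d : ℝ} (h : P.Good δ a b c d) : a ≤ b := by
  have := h.x_mem (Nat.zero_le _); exact this.1.trans this.2

lemma TP.Good.le_y {P : TP} {δ a b c d : ℝ} (h : P.Good δ a b c d) : c ≤ d := by
  have := h.y_mem (Nat.zero_le _); exact this.1.trans this.2

lemma close_of_overlap {a b c d s t δ : ℝ} (hab : a ≤ b) (hcd : c ≤ d)
    (h : clmp a b c < clmp a b d) (hs : s ∈ Set.Icc a b) (ht : t ∈ Set.Icc c d)
    (h1 : b - a < δ) (h2 : d - c < δ) : |s - t| < 2 * δ := by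
  have hcb : c < b := by
    by_contra hcon
    push Not at hcon
    rw [clmp_of_ge hab hcon, clmp_of_ge hab (hcon.trans hcd)] at h
    exact lt_irrefl _ h
  have had : a < d := by
    by_contra hcon
    push Not at hcon
    rw [clmp_of_le hcon, clmp_of_le (hcd.trans hcon)] at h
    exact lt_irrefl _ h
  rw [abs_lt]
  constructor <;> linarith [hs.1, hs.2, ht.1, ht.2]

lemma compare {W g : ℝ → ℝ → ℝ} (hW : RectMono W) {δ ε C : ℝ}
    (hg : ∀ s t s' t', |s - s'| < 2 * δ → |t - t'| < 2 * δ → |g s t - g s' t'| ≤ ε)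
    (hC : ∀ s t, |g s t| ≤ C) {P P' : TP} {a b c d a' b' c' d' : ℝ}
    (hP : P.Good δ a b c d) (hP' : P'.Good δ a' b' c' d')
    (ha : a' ≤ a) (hb : b ≤ b') (hc : c' ≤ c) (hd : d ≤ d') :
    |P.S W g - P'.S W g| ≤ ε * incr W a b c d +
      C * (incr W a' b' c' d' - incr W a b c d) := by
  obtain ⟨hx0, hxn, hy0, hym, hx, hy⟩ := hP.part
  obtain ⟨hx0', hxn', hy0', hym', hx', hy'⟩ := hP'.part
  have hab := hP.le_x
  have hcd := hP.le_y
  set N : ℕ × ℕ → ℕ × ℕ → ℝ := fun i k =>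
    incr W (clmp (P.x i.1) (P.x (i.1+1)) (P'.x k.1)) (clmp (P.x i.1) (P.x (i.1+1)) (P'.x (k.1+1)))
      (clmp (P.y i.2) (P.y (i.2+1)) (P'.y k.2)) (clmp (P.y i.2) (P.y (i.2+1)) (P'.y (k.2+1)))
    with hN
  set I := Finset.range P.n ×ˢ Finset.range P.m with hI
  set K := Finset.range P'.n ×ˢ Finset.range P'.m with hK
  have memI : ∀ i ∈ I, i.1 < P.n ∧ i.2 < P.m := fun i hi => by simpa [hI] using hi
  have memK : ∀ i ∈ K, i.1 < P'.n ∧ i.2 < P'.m := fun i hi => by simpa [hK] using hi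
  set cl : ℕ × ℕ → ℝ := fun k =>
    incr W (clmp (P'.x k.1) (P'.x (k.1+1)) a) (clmp (P'.x k.1) (P'.x (k.1+1)) b)
      (clmp (P'.y k.2) (P'.y (k.2+1)) c) (clmp (P'.y k.2) (P'.y (k.2+1)) d) with hcl
  set r : ℕ × ℕ → ℝ := fun k =>
    incr W (P'.x k.1) (P'.x (k.1+1)) (P'.y k.2) (P'.y (k.2+1)) - cl k with hr
  have sumcl : ∑ k ∈ K, cl k = incr W a b c d := by
    have : ∀ k ∈ K, cl k = incr W (clmp a b (P'.x k.1)) (clmp a b (P'.x (k.1+1)))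
        (clmp c d (P'.y k.2)) (clmp c d (P'.y (k.2+1))) := by
      intro k hk
      obtain ⟨k1, k2⟩ := memK k hk
      simp only [hcl]
      rw [incr_swap_x W (hx' _ k1).le hab, incr_swap_y W (hy' _ k2).le hcd]
    rw [Finset.sum_congr rfl this, hK,
      incr_tel W (fun i => clmp a b (P'.x i)) (fun i => clmp c d (P'.y i)), hx0', hxn', hy0', hym',
      clmp_of_le ha, clmp_of_ge hab hb, clmp_of_le hc, clmp_of_ge hcd hd]
  have sumI : ∑ i ∈ I, incr W (P.x i.1) (P.x (i.1+1)) (P.y i.2) (P.y (i.2+1)) =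
      incr W a b c d := by
    rw [hI, incr_tel, hx0, hxn, hy0, hym]
  have sumr : ∑ k ∈ K, r k = incr W a' b' c' d' - incr W a b c d := by
    simp only [hr]
    rw [Finset.sum_sub_distrib, sumcl, hK, incr_tel, hx0', hxn', hy0', hym']
  rw [TP.S_eq, TP.S_eq, ← sumr]
  conv_rhs => rw [← sumI]
  refine abstract_compare I K N (fun i => g (P.ξ i.1 i.2) (P.η i.1 i.2))
    (fun i => incr W (P.x i.1) (P.x (i.1+1)) (P.y i.2) (P.y (i.2+1)))
    (fun i => g (P'.ξ i.1 i.2) (P'.η i.1 i.2))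
    (fun i => incr W (P'.x i.1) (P'.x (i.1+1)) (P'.y i.2) (P'.y (i.2+1))) r ?_ ?_ ?_ ?_ ?_ ?_
  · intro i hi k hk
    obtain ⟨i1, i2⟩ := memI i hi
    obtain ⟨k1, k2⟩ := memK k hk
    have cx : clmp (P.x i.1) (P.x (i.1+1)) (P'.x k.1) ≤
      clmp (P.x i.1) (P.x (i.1+1)) (P'.x (k.1+1)) := clmp_mono (hx' _ k1).le
    have cy : clmp (P.y i.2) (P.y (i.2+1)) (P'.y k.2) ≤
      clmp (P.y i.2) (P.y (i.2+1)) (P'.y (k.2+1)) := clmp_mono (hy' _ k2).le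
    have hN0 : 0 ≤ N i k := hW _ _ _ _ cx cy
    rcases cx.eq_or_lt with e | ex
    · have : N i k = 0 := by simp only [hN]; rw [e]; simp [incr]
      simp [this]
    rcases cy.eq_or_lt with e | ey
    · have : N i k = 0 := by simp only [hN]; rw [e]; simp [incr]
      simp [this]
    refine mul_le_mul_of_nonneg_right (hg _ _ _ _ ?_ ?_) hN0
    · exact close_of_overlap (hx _ i1).le (hx' _ k1).le ex (hP.tags _ i1 _ i2).1
        (hP'.tags _ k1 _ k2).1 (hP.mesh_x i1 i2) (hP'.mesh_x k1 k2)
    · exact close_of_overlap (hy _ i2).le (hy' _ k2).le ey (hP.tags _ i1 _ i2).2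
        (hP'.tags _ k1 _ k2).2 (hP.mesh_y i1 i2) (hP'.mesh_y k1 k2)
  · intro i hi k hk
    obtain ⟨k1, k2⟩ := memK k hk
    exact hW _ _ _ _ (clmp_mono (hx' _ k1).le) (clmp_mono (hy' _ k2).le)
  · intro k hk
    obtain ⟨k1, k2⟩ := memK k hk
    simp only [hr, hcl, sub_nonneg]
    exact hW.incr_mono (le_clmp _ _ _) (clmp_mono hab) (clmp_le (hx' _ k1).le _)
      (le_clmp _ _ _) (clmp_mono hcd) (clmp_le (hy' _ k2).le _)
  · intro k hk; exact hC _ _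
  · intro i hi
    obtain ⟨i1, i2⟩ := memI i hi
    simp only [hN, hK]
    rw [incr_tel W (fun k => clmp (P.x i.1) (P.x (i.1+1)) (P'.x k))
      (fun k => clmp (P.y i.2) (P.y (i.2+1)) (P'.y k)), hx0', hxn', hy0', hym',
      clmp_of_le (ha.trans (hP.x_mem i1.le).1), clmp_of_ge (hx _ i1).le ((hP.x_mem i1).2.trans hb),
      clmp_of_le (hc.trans (hP.y_mem i2.le).1), clmp_of_ge (hy _ i2).le ((hP.y_mem i2).2.trans hd)]
  · intro k hk
    obtain ⟨k1, k2⟩ := memK k hk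
    have : ∑ i ∈ I, N i k = cl k := by
      have : ∀ i ∈ I, N i k = incr W
          (clmp (P'.x k.1) (P'.x (k.1+1)) (P.x i.1)) (clmp (P'.x k.1) (P'.x (k.1+1)) (P.x (i.1+1)))
          (clmp (P'.y k.2) (P'.y (k.2+1)) (P.y i.2))
          (clmp (P'.y k.2) (P'.y (k.2+1)) (P.y (i.2+1))) := by
        intro i hi
        obtain ⟨i1, i2⟩ := memI i hi
        simp only [hN]
        rw [incr_swap_x W (hx _ i1).le (hx' _ k1).le, incr_swap_y W (hy _ i2).le (hy' _ k2).le]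
      rw [Finset.sum_congr rfl this, hI,
        incr_tel W (fun i => clmp (P'.x k.1) (P'.x (k.1+1)) (P.x i))
          (fun i => clmp (P'.y k.2) (P'.y (k.2+1)) (P.y i)), hx0, hxn, hy0, hym]
    rw [this, hr]; ring

/-- Good partitions exist. -/
lemma exists_good {δ a b c d : ℝ} (hδ : 0 < δ) (hab : a < b) (hcd : c < d) :
    ∃ P : TP, P.Good δ a b c d := by
  obtain ⟨N, hN⟩ := exists_nat_gt (((b - a) + (d - c)) / δ)
  have hNpos : (0:ℝ) < N := lt_of_le_of_lt (by apply div_nonneg <;> linarith) hN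
  have hN' : ((b - a) + (d - c)) / N < δ := by
    rw [div_lt_iff₀ hδ] at hN; rw [div_lt_iff₀ hNpos]; linarith
  have sx : 0 < (b - a) / N := div_pos (by linarith) hNpos
  have sy : 0 < (d - c) / N := div_pos (by linarith) hNpos
  refine ⟨⟨N, N, fun i => a + i * ((b - a) / N), fun i => c + i * ((d - c) / N),
    fun i _ => a + i * ((b - a) / N), fun _ i => c + i * ((d - c) / N)⟩, ⟨?_, ?_, ?_⟩⟩
  · refine ⟨by simp, ?_, by simp, ?_, ?_, ?_⟩
    · show a + N * ((b - a) / N) = b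
      field_simp; ring
    · show c + N * ((d - c) / N) = d
      field_simp; ring
    · intro i _
      show a + i * ((b - a) / N) < a + (i + 1 : ℕ) * ((b - a) / N)
      push_cast; nlinarith
    · intro i _
      show c + i * ((d - c) / N) < c + (i + 1 : ℕ) * ((d - c) / N)
      push_cast; nlinarith
  · intro i _ j _
    simp only [Set.mem_Icc]
    push_cast
    refine ⟨⟨le_rfl, ?_⟩, ⟨le_rfl, ?_⟩⟩ <;> nlinarith
  · intro i _ j _
    simp only
    push_cast
    refine lt_of_le_of_lt ?_ hN'
    rw [add_div]
    refine Real.sqrt_le_iff.2 ⟨by positivity, ?_⟩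
    nlinarith [mul_pos sx sy]

/-! ### Part 3: limits of Riemann–Stieltjes sums -/

lemma TP.Good.mono {P : TP} {δ δ' a b c d : ℝ} (h : P.Good δ a b c d) (hd : δ ≤ δ') :
    P.Good δ' a b c d :=
  ⟨h.part, h.tags, fun i hi j hj => (h.mesh i hi j hj).trans_le hd⟩

lemma limit_of_cauchy (F : ℕ → Set TP) (hF : Antitone F) (hne : ∀ N, (F N).Nonempty) (S : TP → ℝ)
    (hS : ∀ ε > 0, ∃ N, ∀ P ∈ F N, ∀ P' ∈ F N, |S P - S P'| < ε) :
    ∃ L : ℝ, ∀ ε > 0, ∃ N, ∀ P ∈ F N, |S P - L| < ε := by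
  choose p hp using hne
  have hc : CauchySeq fun n => S (p n) := by
    refine Metric.cauchySeq_iff.2 fun ε hε => ?_
    obtain ⟨N, hN⟩ := hS ε hε
    exact ⟨N, fun m hm n hn => hN _ (hF hm (hp m)) _ (hF hn (hp n))⟩
  obtain ⟨L, hL⟩ := cauchySeq_tendsto_of_complete hc
  refine ⟨L, fun ε hε => ?_⟩
  obtain ⟨N, hN⟩ := hS (ε/2) (by linarith)
  refine ⟨N, fun P hP => ?_⟩
  obtain ⟨N', hN'⟩ := Metric.tendsto_atTop.1 hL (ε/2) (by linarith)
  have h1 := hN' (max N N') (le_max_right _ _)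
  have h2 := hN P hP _ (hF (le_max_left N N') (hp _))
  rw [Real.dist_eq] at h1
  have := abs_sub_le (S P) (S (p (max N N'))) L
  linarith

/-- Continuous functions vanishing at infinity. -/
def C0 (g : ℝ → ℝ → ℝ) : Prop :=
  Continuous (fun p : ℝ × ℝ => g p.1 p.2) ∧
    Tendsto (fun p : ℝ × ℝ => g p.1 p.2) (cocompact (ℝ × ℝ)) (𝓝 0)

lemma C0.bdd {g : ℝ → ℝ → ℝ} (hg : C0 g) : ∃ C > 0, ∀ s t, |g s t| ≤ C := by
  obtain ⟨K, hK, hK'⟩ := mem_cocompact.1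
    (hg.2 (Metric.ball_mem_nhds (0:ℝ) one_pos))
  obtain ⟨C, hC⟩ := hK.exists_bound_of_continuousOn hg.1.continuousOn
  refine ⟨max C 1, by positivity, fun s t => ?_⟩
  by_cases h : (s, t) ∈ K
  · exact (hC _ h).trans (le_max_left _ _)
  · have := hK' h
    simp at this
    exact this.le.trans (le_max_right _ _)

lemma C0.unif {g : ℝ → ℝ → ℝ} (hg : C0 g) {ε : ℝ} (hε : 0 < ε) :
    ∃ δ > 0, ∀ s t s' t', |s - s'| < 2 * δ → |t - t'| < 2 * δ → |g s t - g s' t'| ≤ ε := by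
  have hu := hg.1.uniformContinuous_of_tendsto_cocompact hg.2
  obtain ⟨δ, hδ, h⟩ := Metric.uniformContinuous_iff.1 hu ε hε
  refine ⟨δ/2, by linarith, fun s t s' t' h1 h2 => ?_⟩
  have : dist (s, t) (s', t') < δ := by
    rw [Prod.dist_eq, Real.dist_eq, Real.dist_eq]
    exact max_lt (by simpa using (by linarith : |s - s'| < δ))
      (by simpa using (by linarith : |t - t'| < δ))
  exact (h this).le

/-- Fine partitions of large rectangles. -/
def FF (N : ℕ) : Set TP :=
  {P | ∃ a b c d : ℝ, a ≤ -(N+1) ∧ (N+1) ≤ b ∧ c ≤ -(N+1) ∧ (N+1) ≤ d ∧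
    P.Good (1 / ((N:ℝ)+1)) a b c d}

lemma FF_anti : Antitone FF := by
  intro N N' h P ⟨a, b, c, d, h1, h2, h3, h4, h5⟩
  have : (N:ℝ) ≤ N' := by exact_mod_cast h
  exact ⟨a, b, c, d, by linarith, by linarith, by linarith, by linarith,
    h5.mono (one_div_le_one_div_of_le (by positivity) (by linarith))⟩

lemma FF_nonempty (N : ℕ) : (FF N).Nonempty := by
  have hN : (0:ℝ) < (N:ℝ) + 1 := by positivity
  obtain ⟨P, hP⟩ := exists_good (δ := 1 / ((N:ℝ)+1)) (a := -(N+1)) (b := N+1) (c := -(N+1))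
    (d := N+1) (by positivity) (by linarith) (by linarith)
  exact ⟨P, _, _, _, _, le_rfl, le_rfl, le_rfl, le_rfl, hP⟩

lemma cauchy_FF {f g : ℝ → ℝ → ℝ} (hf : BVV f) (hg : C0 g) :
    ∀ ε > 0, ∃ N, ∀ P ∈ FF N, ∀ P' ∈ FF N, |P.S (varFun f) g - P'.S (varFun f) g| < ε := by
  intro ε hε
  have hW : RectMono (varFun f) := fun a b c d => incr_varFun_nonneg hf
  set T := (vitaliVar f Set.univ).toReal with hT
  have hT0 : 0 ≤ T := ENNReal.toReal_nonneg
  obtain ⟨C, hC0, hC⟩ := hg.bdd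
  obtain ⟨δ, hδ, hu⟩ := hg.unif (ε := ε / (4 * (T + 1))) (by positivity)
  obtain ⟨M, hM0, hM⟩ := incr_varFun_gt hf (ε := ε / (4 * C)) (by positivity)
  obtain ⟨N₁, hN₁⟩ := exists_nat_gt M
  obtain ⟨N₂, hN₂⟩ := exists_nat_one_div_lt hδ
  obtain ⟨P₀, hP₀⟩ := exists_good hδ (show -M < M by linarith) (show -M < M by linarith)
  have key : ∀ P ∈ FF (max N₁ N₂), |P₀.S (varFun f) g - P.S (varFun f) g| < ε / 2 := by
    intro P hP
    obtain ⟨a, b, c, d, h1, h2, h3, h4, -⟩ := FF_anti (le_max_left N₁ N₂) hP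
    obtain ⟨a', b', c', d', -, -, -, -, h5⟩ := FF_anti (le_max_right N₁ N₂) hP
    obtain ⟨a, b, c, d, h1, h2, h3, h4, h5⟩ := hP
    have e1 : (N₁:ℝ) ≤ (max N₁ N₂ : ℕ) := by exact_mod_cast le_max_left _ _
    have e2 : (N₂:ℝ) ≤ (max N₁ N₂ : ℕ) := by exact_mod_cast le_max_right _ _
    have h6 : P.Good δ a b c d := h5.mono <|
      (one_div_le_one_div_of_le (by positivity) (by linarith)).trans hN₂.le
    have := compare hW hu hC hP₀ h6 (by linarith) (by linarith) (by linarith) (by linarith)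
    refine this.trans_lt ?_
    have q1 : incr (varFun f) a b c d ≤ T := incr_varFun_le hf (by linarith) (by linarith)
    have q2 : incr (varFun f) (-M) M (-M) M ≤ T := incr_varFun_le hf (by linarith) (by linarith)
    have q3 : ε / (4 * (T + 1)) * incr (varFun f) (-M) M (-M) M ≤ ε / (4 * (T + 1)) * T :=
      mul_le_mul_of_nonneg_left q2 (by positivity)
    have q4 : ε / (4 * (T + 1)) * T < ε / 4 := by
      rw [div_mul_eq_mul_div, div_lt_div_iff₀ (by positivity) (by positivity)]
      nlinarith
    have q5 : C * (incr (varFun f) a b c d - incr (varFun f) (-M) M (-M) M) ≤ C * (ε / (4 * C)) :=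
      mul_le_mul_of_nonneg_left (by linarith) hC0.le
    have q6 : C * (ε / (4 * C)) = ε / 4 := by field_simp
    linarith
  refine ⟨max N₁ N₂, fun P hP P' hP' => ?_⟩
  have h1 := key P hP
  have h2 := key P' hP'
  rw [abs_sub_comm] at h1
  have := abs_sub_le (P.S (varFun f) g) (P₀.S (varFun f) g) (P'.S (varFun f) g)
  linarith

lemma exists_RS {f g : ℝ → ℝ → ℝ} (hf : BVV f) (hg : C0 g) {a b c d : ℝ} (hab : a < b)
    (hcd : c < d) : ∃ B, RSIntegralOn g (varFun f) a b c d B := by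
  have hW : RectMono (varFun f) := fun a b c d => incr_varFun_nonneg hf
  set F : ℕ → Set TP := fun N => {P | P.Good (1 / ((N:ℝ)+1)) a b c d} with hF
  have hanti : Antitone F := by
    intro N N' h P hP
    have : (N:ℝ) ≤ N' := by exact_mod_cast h
    exact TP.Good.mono hP (one_div_le_one_div_of_le (by positivity) (by linarith))
  obtain ⟨C, hC0, hC⟩ := hg.bdd
  obtain ⟨B, hB⟩ := limit_of_cauchy F hanti
    (fun N => exists_good (by positivity) hab hcd) (fun P => P.S (varFun f) g) (by
      intro ε hε
      have hI := hW a b c d hab.le hcd.le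
      obtain ⟨δ, hδ, hu⟩ := hg.unif (ε := ε / (incr (varFun f) a b c d + 1)) (by positivity)
      obtain ⟨N, hN⟩ := exists_nat_one_div_lt hδ
      refine ⟨N, fun P hP P' hP' => ?_⟩
      refine (compare hW hu hC (TP.Good.mono hP hN.le) (TP.Good.mono hP' hN.le)
        le_rfl le_rfl le_rfl le_rfl).trans_lt ?_
      rw [sub_self, mul_zero, add_zero, div_mul_eq_mul_div, div_lt_iff₀ (by positivity)]
      nlinarith)
  refine ⟨B, fun ε hε => ?_⟩
  obtain ⟨N, hN⟩ := hB ε hε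
  refine ⟨1 / ((N:ℝ)+1), by positivity, fun n m x y ξ η h1 h2 h3 => ?_⟩
  exact hN ⟨n, m, x, y, ξ, η⟩ ⟨h1, h2, h3⟩

lemma RS_use {g W : ℝ → ℝ → ℝ} {a b c d B : ℝ} (h : RSIntegralOn g W a b c d B) {ε : ℝ}
    (hε : 0 < ε) : ∃ δ > 0, ∀ P : TP, P.Good δ a b c d → |P.S W g - B| < ε := by
  obtain ⟨δ, hδ, h⟩ := h ε hε
  exact ⟨δ, hδ, fun P hP => h _ _ _ _ _ _ hP.part hP.tags hP.mesh⟩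

/-- The limit of Riemann–Stieltjes sums along fine partitions of large rectangles. -/
def IsLim (W g : ℝ → ℝ → ℝ) (L : ℝ) : Prop :=
  ∀ ε > 0, ∃ N, ∀ P ∈ FF N, |P.S W g - L| < ε

lemma exists_isLim {f g : ℝ → ℝ → ℝ} (hf : BVV f) (hg : C0 g) : ∃ L, IsLim (varFun f) g L :=
  limit_of_cauchy FF FF_anti FF_nonempty _ (cauchy_FF hf hg)

lemma improper_of_isLim {f g : ℝ → ℝ → ℝ} (hf : BVV f) (hg : C0 g) {L : ℝ}
    (hL : IsLim (varFun f) g L) : ImproperRS g (varFun f) L := by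
  intro ε hε
  obtain ⟨N, hN⟩ := hL (ε/2) (by linarith)
  refine ⟨N+1, fun a b c d h1 h2 h3 h4 => ?_⟩
  have hN0 : (0:ℝ) < (N:ℝ)+1 := by positivity
  obtain ⟨B, hB⟩ := exists_RS hf hg (show a < b by linarith) (show c < d by linarith)
  refine ⟨B, hB, ?_⟩
  obtain ⟨δ, hδ, hB'⟩ := RS_use hB (ε := ε/2) (by linarith)
  obtain ⟨P, hP⟩ := exists_good (δ := min δ (1 / ((N:ℝ)+1))) (lt_min hδ (by positivity))
    (show a < b by linarith) (show c < d by linarith)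
  have k1 := hB' P (hP.mono (min_le_left _ _))
  have k2 := hN P ⟨a, b, c, d, h1, h2, h3, h4, hP.mono (min_le_right _ _)⟩
  rw [abs_sub_comm] at k1
  have := abs_sub_le B (P.S (varFun f) g) L
  linarith

lemma improper_unique {g W : ℝ → ℝ → ℝ} {L L' : ℝ} (h : ImproperRS g W L)
    (h' : ImproperRS g W L') : L = L' := by
  by_contra hne
  have hpos : 0 < |L - L'| := abs_pos.2 (sub_ne_zero.2 hne)
  obtain ⟨M, hM⟩ := h (|L - L'| / 4) (by linarith)
  obtain ⟨M', hM'⟩ := h' (|L - L'| / 4) (by linarith)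
  set R := max 1 (max M M') with hR
  have r1 : 1 ≤ R := le_max_left _ _
  have r2 : M ≤ R := (le_max_left _ _).trans (le_max_right _ _)
  have r3 : M' ≤ R := (le_max_right _ _).trans (le_max_right _ _)
  obtain ⟨B, hB, hBL⟩ := hM (-R) R (-R) R (by linarith) r2 (by linarith) r2
  obtain ⟨B', hB', hBL'⟩ := hM' (-R) R (-R) R (by linarith) r3 (by linarith) r3
  obtain ⟨δ, hδ, k⟩ := RS_use hB (ε := |L - L'| / 4) (by linarith)
  obtain ⟨δ', hδ', k'⟩ := RS_use hB' (ε := |L - L'| / 4) (by linarith)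
  obtain ⟨P, hP⟩ := exists_good (lt_min hδ hδ') (show -R < R by linarith)
    (show -R < R by linarith)
  have k1 := k P (hP.mono (min_le_left _ _))
  have k2 := k' P (hP.mono (min_le_right _ _))
  have : |L - L'| < |L - L'| := by
    conv_lhs => rw [show L - L' = -(B - L) + (-(P.S W g - B)) + (P.S W g - B') + (B' - L') by ring]
    refine (abs_add_le _ _).trans_lt ?_
    have := abs_add_le (-(B - L) + (-(P.S W g - B))) (P.S W g - B')
    have := abs_add_le (-(B - L)) (-(P.S W g - B))
    rw [abs_neg, abs_neg] at this
    linarith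
  exact lt_irrefl _ this

/-- A fixed sequence of partitions. -/
def PP (N : ℕ) : TP := Classical.choose (FF_nonempty N)

lemma PP_mem (N : ℕ) : PP N ∈ FF N := Classical.choose_spec (FF_nonempty N)

lemma IsLim.tendsto {W g : ℝ → ℝ → ℝ} {L : ℝ} (h : IsLim W g L) :
    Tendsto (fun N => (PP N).S W g) atTop (𝓝 L) := by
  refine Metric.tendsto_atTop.2 fun ε hε => ?_
  obtain ⟨N, hN⟩ := h ε hε
  exact ⟨N, fun n hn => hN _ (FF_anti hn (PP_mem n))⟩

/-- The functional. -/
def lam (W g : ℝ → ℝ → ℝ) : ℝ := limUnder atTop fun N => (PP N).S W g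

lemma IsLim.eq_lam {W g : ℝ → ℝ → ℝ} {L : ℝ} (h : IsLim W g L) : lam W g = L :=
  h.tendsto.limUnder_eq

lemma isLim_lam {f g : ℝ → ℝ → ℝ} (hf : BVV f) (hg : C0 g) : IsLim (varFun f) g (lam (varFun f) g) := by
  obtain ⟨L, hL⟩ := exists_isLim hf hg
  rwa [hL.eq_lam]

lemma S_add (P : TP) (W g h : ℝ → ℝ → ℝ) :
    P.S W (fun s t => g s t + h s t) = P.S W g + P.S W h := by
  simp only [TP.S_eq, add_mul, Finset.sum_add_distrib]

lemma S_smul (P : TP) (W g : ℝ → ℝ → ℝ) (r : ℝ) :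
    P.S W (fun s t => r * g s t) = r * P.S W g := by
  simp only [TP.S_eq, mul_assoc, Finset.mul_sum]

lemma S_nonneg {P : TP} {W g : ℝ → ℝ → ℝ} (hW : RectMono W) (hg : ∀ s t, 0 ≤ g s t)
    {δ a b c d : ℝ} (hP : P.Good δ a b c d) : 0 ≤ P.S W g := by
  rw [TP.S_eq]
  refine Finset.sum_nonneg fun k hk => mul_nonneg (hg _ _) ?_
  simp at hk
  exact hW _ _ _ _ (hP.x_lt hk.1).le (hP.y_lt hk.2).le

lemma S_sub_le {P : TP} {W g h : ℝ → ℝ → ℝ} (hW : RectMono W) {ε : ℝ}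
    (hg : ∀ s t, |g s t - h s t| ≤ ε)
    {δ a b c d : ℝ} (hP : P.Good δ a b c d) : |P.S W g - P.S W h| ≤ ε * incr W a b c d := by
  obtain ⟨hx0, hxn, hy0, hym, hx, hy⟩ := hP.part
  rw [TP.S_eq, TP.S_eq, ← Finset.sum_sub_distrib]
  refine (Finset.abs_sum_le_sum_abs _ _).trans ?_
  rw [← hx0, ← hxn, ← hy0, ← hym, ← incr_tel, Finset.mul_sum]
  refine Finset.sum_le_sum fun k hk => ?_
  simp at hk
  have := hW _ _ _ _ (hP.x_lt hk.1).le (hP.y_lt hk.2).le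
  rw [← sub_mul, abs_mul, abs_of_nonneg this]
  exact mul_le_mul_of_nonneg_right (hg _ _) this

lemma S_le_incr {P : TP} {W g : ℝ → ℝ → ℝ} (hW : RectMono W)
    (hg1 : ∀ s t, g s t ≤ 1) {a b c d δ a' b' c' d' : ℝ} (hP : P.Good δ a' b' c' d')
    (hab : a ≤ b) (hcd : c ≤ d) (ha : a' ≤ a) (hb : b ≤ b') (hc : c' ≤ c) (hd : d ≤ d')
    (hsupp : ∀ i < P.n, ∀ j < P.m, g (P.ξ i j) (P.η i j) ≠ 0 →
      a ≤ P.x i ∧ P.x (i+1) ≤ b ∧ c ≤ P.y j ∧ P.y (j+1) ≤ d) :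
    P.S W g ≤ incr W a b c d := by
  obtain ⟨hx0, hxn, hy0, hym, hx, hy⟩ := hP.part
  have e : incr W a b c d = ∑ k ∈ Finset.range P.n ×ˢ Finset.range P.m,
      incr W (clmp a b (P.x k.1)) (clmp a b (P.x (k.1+1)))
        (clmp c d (P.y k.2)) (clmp c d (P.y (k.2+1))) := by
    rw [incr_tel W (fun i => clmp a b (P.x i)) (fun i => clmp c d (P.y i)), hx0, hxn, hy0, hym,
      clmp_of_le ha, clmp_of_ge hab hb, clmp_of_le hc, clmp_of_ge hcd hd]
  rw [TP.S_eq, e]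
  refine Finset.sum_le_sum fun k hk => ?_
  simp at hk
  have l1 := (hP.x_lt hk.1).le
  have l2 := (hP.y_lt hk.2).le
  by_cases h0 : g (P.ξ k.1 k.2) (P.η k.1 k.2) = 0
  · rw [h0, zero_mul]; exact hW _ _ _ _ (clmp_mono l1) (clmp_mono l2)
  · obtain ⟨q1, q2, q3, q4⟩ := hsupp _ hk.1 _ hk.2 h0
    rw [clmp_of_mem q1 (by linarith), clmp_of_mem (by linarith) q2, clmp_of_mem q3 (by linarith),
      clmp_of_mem (by linarith) q4]
    have := mul_le_mul_of_nonneg_right (hg1 (P.ξ k.1 k.2) (P.η k.1 k.2)) (hW _ _ _ _ l1 l2)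
    linarith

/-! ### Part 4: the Riesz measure -/

open CompactlySupported in
lemma C0_of_Cc (φ : C_c(ℝ × ℝ, ℝ)) : C0 fun s t => φ (s, t) :=
  ⟨φ.continuous, φ.hasCompactSupport.is_zero_at_infty⟩

open CompactlySupported in
/-- The positive functional on `C_c`. -/
def Lam (f : ℝ → ℝ → ℝ) (hf : BVV f) : C_c(ℝ × ℝ, ℝ) →ₚ[ℝ] ℝ :=
  PositiveLinearMap.mk₀
    { toFun := fun φ => lam (varFun f) fun s t => φ (s, t)
      map_add' := by
        intro φ ψ
        have h := (isLim_lam hf (C0_of_Cc φ)).tendsto.add (isLim_lam hf (C0_of_Cc ψ)).tendsto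
        simp only [← S_add] at h
        exact h.limUnder_eq
      map_smul' := by
        intro r φ
        have h := (isLim_lam hf (C0_of_Cc φ)).tendsto.const_mul r
        simp only [← S_smul] at h
        exact h.limUnder_eq }
    (by
      intro φ hφ
      refine ge_of_tendsto' (isLim_lam hf (C0_of_Cc φ)).tendsto fun N => ?_
      obtain ⟨a, b, c, d, -, -, -, -, h⟩ := PP_mem N
      exact S_nonneg (fun a b c d => incr_varFun_nonneg hf) (fun s t => hφ (s, t)) h)

open CompactlySupported in
lemma Lam_apply (f : ℝ → ℝ → ℝ) (hf : BVV f) (φ : C_c(ℝ × ℝ, ℝ)) :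
    Lam f hf φ = lam (varFun f) fun s t => φ (s, t) := rfl

/-- The measure. -/
def muV (f : ℝ → ℝ → ℝ) (hf : BVV f) : Measure (ℝ × ℝ) := RealRMK.rieszMeasure (Lam f hf)

lemma muV_finite (f : ℝ → ℝ → ℝ) (hf : BVV f) : IsFiniteMeasure (muV f hf) := by
  refine ⟨?_⟩
  suffices muV f hf Set.univ ≤ vitaliVar f Set.univ from this.trans_lt hf
  have : (muV f hf).Regular := RealRMK.regular_rieszMeasure (Lam f hf)
  rw [isOpen_univ.measure_eq_iSup_isCompact]
  refine iSup₂_le fun K _ => iSup_le fun hK => ?_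
  obtain ⟨φ, h1, -, h3, h4⟩ := exists_continuous_one_zero_of_isCompact hK isClosed_empty
    (disjoint_empty K)
  refine (RealRMK.rieszMeasure_le_of_eq_one (Lam f hf) (f := ⟨φ, h3⟩) (fun x => (h4 x).1) hK
    (fun x hx => h1 hx)).trans ?_
  refine ENNReal.ofReal_le_of_le_toReal ?_
  rw [Lam_apply]
  refine le_of_tendsto' (isLim_lam hf (C0_of_Cc _)).tendsto fun N => ?_
  obtain ⟨a, b, c, d, ha, hb, hc, hd, h⟩ := PP_mem N
  refine (S_le_incr (fun a b c d => incr_varFun_nonneg hf) (fun s t => (h4 (s, t)).2) h h.le_x h.le_y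
    le_rfl le_rfl le_rfl le_rfl ?_).trans (incr_varFun_le hf h.le_x h.le_y)
  intro i hi j hj _
  exact ⟨(h.x_mem hi.le).1, (h.x_mem hi).2, (h.y_mem hj.le).1, (h.y_mem hj).2⟩

lemma muV_rect (f : ℝ → ℝ → ℝ) (hf : BVV f) (a b c d : ℝ) :
    muV f hf (Set.Ioo a b ×ˢ Set.Ioo c d) ≤ vitaliVar f (Set.Icc a b ×ˢ Set.Icc c d) := by
  rcases le_or_gt b a with hab | hab
  · simp [Set.Ioo_eq_empty (not_lt.2 hab)]
  rcases le_or_gt d c with hcd | hcd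
  · simp [Set.Ioo_eq_empty (not_lt.2 hcd)]
  have hU : IsOpen (Set.Ioo a b ×ˢ Set.Ioo c d) := isOpen_Ioo.prod isOpen_Ioo
  have : (muV f hf).Regular := RealRMK.regular_rieszMeasure (Lam f hf)
  rw [hU.measure_eq_iSup_isCompact]
  refine iSup₂_le fun K hKU => iSup_le fun hK => ?_
  obtain ⟨k, hk, hKk, hkU⟩ := exists_compact_between hK hU hKU
  obtain ⟨φ, h1, h2, h3, h4⟩ := exists_continuous_one_zero_of_isCompact hK
    isOpen_interior.isClosed_compl (disjoint_compl_right_iff_subset.mpr hKk)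
  obtain ⟨δ, hδ, hδU⟩ := hk.exists_thickening_subset_open hU hkU
  refine (RealRMK.rieszMeasure_le_of_eq_one (Lam f hf) (f := ⟨φ, h3⟩) (fun x => (h4 x).1) hK
    (fun x hx => h1 hx)).trans ?_
  rw [← ENNReal.ofReal_toReal (vitaliVar_ne_top hf (Set.Icc a b ×ˢ Set.Icc c d)),
    ← incr_varFun hf hab.le hcd.le]
  refine ENNReal.ofReal_le_ofReal ?_
  rw [Lam_apply]
  refine le_of_tendsto (isLim_lam hf (C0_of_Cc _)).tendsto ?_
  obtain ⟨N₁, hN₁⟩ := exists_nat_gt (|a| + |b| + |c| + |d|)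
  obtain ⟨N₂, hN₂⟩ := exists_nat_one_div_lt hδ
  filter_upwards [eventually_ge_atTop (max N₁ N₂)] with N hN
  have e1 : (N₁:ℝ) ≤ N := by exact_mod_cast (le_max_left _ _).trans hN
  have e2 : (N₂:ℝ) ≤ N := by exact_mod_cast (le_max_right _ _).trans hN
  obtain ⟨a', b', c', d', ha, hb, hc, hd, h⟩ := PP_mem N
  have h' : (PP N).Good δ a' b' c' d' := h.mono <|
    (one_div_le_one_div_of_le (by positivity) (by linarith)).trans hN₂.le
  have := abs_nonneg a
  have := abs_nonneg b
  have := abs_nonneg c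
  have := abs_nonneg d
  refine S_le_incr (fun a b c d => incr_varFun_nonneg hf) (fun s t => (h4 (s, t)).2) h' hab.le hcd.le
    (by linarith [neg_abs_le a]) (by linarith [le_abs_self b]) (by linarith [neg_abs_le c])
    (by linarith [le_abs_self d]) ?_
  intro i hi j hj hne
  have hmem : ((PP N).ξ i j, (PP N).η i j) ∈ k := by
    by_contra hcon
    exact hne (h2 fun hc => hcon (interior_subset hc))
  obtain ⟨⟨t1, t2⟩, ⟨t3, t4⟩⟩ := h'.tags i hi j hj
  have m1 := h'.mesh_x hi hj
  have m2 := h'.mesh_y hi hj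
  have p1 : ((PP N).x i, (PP N).y j) ∈ Metric.thickening δ k := by
    refine Metric.mem_thickening_iff.2 ⟨_, hmem, ?_⟩
    rw [Prod.dist_eq, Real.dist_eq, Real.dist_eq]
    refine max_lt ?_ ?_ <;> rw [abs_lt] <;> constructor <;> dsimp only <;> linarith
  have p2 : ((PP N).x (i+1), (PP N).y (j+1)) ∈ Metric.thickening δ k := by
    refine Metric.mem_thickening_iff.2 ⟨_, hmem, ?_⟩
    rw [Prod.dist_eq, Real.dist_eq, Real.dist_eq]
    refine max_lt ?_ ?_ <;> rw [abs_lt] <;> constructor <;> dsimp only <;> linarith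
  have p1' := hδU p1
  have p2' := hδU p2
  exact ⟨p1'.1.1.le, p2'.1.2.le, p1'.2.1.le, p2'.2.2.le⟩

lemma lam_eq_integral {f g : ℝ → ℝ → ℝ} (hf : BVV f) (hg : C0 g) :
    lam (varFun f) g = ∫ p : ℝ × ℝ, g p.1 p.2 ∂(muV f hf) := by
  have hfin := muV_finite f hf
  have hW : RectMono (varFun f) := fun a b c d => incr_varFun_nonneg hf
  set T := (vitaliVar f Set.univ).toReal with hT
  have hT0 : 0 ≤ T := ENNReal.toReal_nonneg
  set m := (muV f hf).real Set.univ with hm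
  have hm0 : 0 ≤ m := measureReal_nonneg
  obtain ⟨C, hC0, hC⟩ := hg.bdd
  have key : ∀ ε > 0, |lam (varFun f) g - ∫ p : ℝ × ℝ, g p.1 p.2 ∂(muV f hf)| ≤ ε * (T + m) := by
    intro ε hε
    set k : ℝ × ℝ → ℝ := fun p => g p.1 p.2 - clmp (-ε) ε (g p.1 p.2) with hk
    have hclb : ∀ t : ℝ, |clmp (-ε) ε t| ≤ ε := fun t =>
      abs_le.2 ⟨le_clmp _ _ _, clmp_le (by linarith) _⟩
    have hkc : Continuous k := by
      have : Continuous fun t : ℝ => clmp (-ε) ε t := by unfold clmp; fun_prop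
      exact hg.1.sub (this.comp hg.1)
    have hks : HasCompactSupport k := by
      obtain ⟨K, hK, hK'⟩ := mem_cocompact.1 (hg.2 (Metric.ball_mem_nhds (0:ℝ) hε))
      refine HasCompactSupport.intro hK fun p hp => ?_
      have := hK' hp
      simp [abs_lt] at this
      simp only [hk]
      rw [clmp_of_mem (by linarith) (by linarith), sub_self]
    set φ : CompactlySupportedContinuousMap (ℝ × ℝ) ℝ := ⟨⟨k, hkc⟩, hks⟩ with hφ
    have hφk : ∀ p, φ p = k p := fun _ => rfl
    have e1 : ∫ p, k p ∂(muV f hf) = lam (varFun f) fun s t => k (s, t) :=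
      RealRMK.integral_rieszMeasure (Lam f hf) φ
    have e2 : |lam (varFun f) g - lam (varFun f) fun s t => k (s, t)| ≤ ε * T := by
      have hlim := ((isLim_lam hf hg).tendsto.sub (isLim_lam hf (C0_of_Cc φ)).tendsto).abs
      refine le_of_tendsto' hlim fun N => ?_
      obtain ⟨a, b, c, d, -, -, -, -, h⟩ := PP_mem N
      refine (S_sub_le hW (ε := ε) (fun s t => ?_) h).trans
        (mul_le_mul_of_nonneg_left (incr_varFun_le hf h.le_x h.le_y) hε.le)
      rw [hφk]; simp only [hk, sub_sub_cancel]; exact hclb _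
    have i1 : Integrable (fun p : ℝ × ℝ => g p.1 p.2) (muV f hf) :=
      Integrable.of_bound hg.1.aestronglyMeasurable C (Eventually.of_forall fun p => hC _ _)
    have i2 : Integrable k (muV f hf) := hkc.integrable_of_hasCompactSupport hks
    have e3 : |∫ p, k p ∂(muV f hf) - ∫ p : ℝ × ℝ, g p.1 p.2 ∂(muV f hf)| ≤ ε * m := by
      rw [← integral_sub i2 i1]
      refine norm_integral_le_of_norm_le_const (μ := muV f hf)
        (f := fun p : ℝ × ℝ => k p - g p.1 p.2) (C := ε) (Eventually.of_forall fun p => ?_)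
      have := hclb (g p.1 p.2)
      simp only [hk, sub_sub_cancel_left, norm_neg]
      exact this
    rw [← e1] at e2
    have := abs_sub_le (lam (varFun f) g) (∫ p, k p ∂(muV f hf))
      (∫ p : ℝ × ℝ, g p.1 p.2 ∂(muV f hf))
    linarith
  by_contra hne
  have hpos := abs_pos.2 (sub_ne_zero.2 hne)
  set A := |lam (varFun f) g - ∫ p : ℝ × ℝ, g p.1 p.2 ∂(muV f hf)| with hA
  have h1 := key (A / (2 * (T + m + 1))) (by positivity)
  rw [div_mul_eq_mul_div, le_div_iff₀ (by positivity)] at h1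
  nlinarith

/-- Riesz-representation theorem for the variation function: for `f ∈ BV_V(ℝ²)` there is a
unique positive finite (Borel) measure `μ` with `μ((a,b)×(c,d)) ≤ Var(f,[a,b]×[c,d])` and,
for every `g ∈ C₀(ℝ²)`, `∬ g dV(f;·,·) = ∬ g dμ`. -/
theorem stmt10 (f : ℝ → ℝ → ℝ) (hf : BVV f) :
    ∃! μ : Measure (ℝ × ℝ), IsFiniteMeasure μ ∧
      (∀ a b c d : ℝ,
        μ (Set.Ioo a b ×ˢ Set.Ioo c d) ≤ vitaliVar f (Set.Icc a b ×ˢ Set.Icc c d)) ∧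
      (∀ g : ℝ → ℝ → ℝ, Continuous (fun p : ℝ × ℝ => g p.1 p.2) →
        Tendsto (fun p : ℝ × ℝ => g p.1 p.2) (cocompact (ℝ × ℝ)) (𝓝 0) →
        ∃ L : ℝ,
          ImproperRS g (fun t₁ t₂ => (vitaliVar f (Set.Iic t₁ ×ˢ Set.Iic t₂)).toReal) L ∧
          L = ∫ p : ℝ × ℝ, g p.1 p.2 ∂μ) := by
  have hfin := muV_finite f hf
  have main : ∀ g : ℝ → ℝ → ℝ, C0 g →
      ImproperRS g (varFun f) (∫ p : ℝ × ℝ, g p.1 p.2 ∂(muV f hf)) := by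
    intro g hg
    rw [← lam_eq_integral hf hg]
    exact improper_of_isLim hf hg (isLim_lam hf hg)
  refine ⟨muV f hf, ⟨hfin, muV_rect f hf, fun g hg1 hg2 => ⟨_, main g ⟨hg1, hg2⟩, rfl⟩⟩, ?_⟩
  rintro ν ⟨hν, -, hν2⟩
  refine Measure.ext_of_integral_eq_on_compactlySupported fun φ => ?_
  have hφ := C0_of_Cc φ
  obtain ⟨L, hL, hLe⟩ := hν2 (fun s t => φ (s, t)) hφ.1 hφ.2
  have := improper_unique hL (main _ hφ)
  exact hLe.symm.trans this
end
end
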